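/- arXiv:2503.19882 — 2 statements merged into one kernel-verified Lean document; each statement's English description precedes it below -/
import Mathlib

section
/- Let μ ∈ ℤⁿ and set χ_α := (0,…,0,1) ∈ ℂ^k. Then: (a) the fiber Φ_α^{−1}(χ_α) := {y ∈ Gr_μ : Φ_α(y) = χ_α} equals the set of elements m(τ_α(y(p,1,0,g)), y₂) with p ∈ ℂ, g ∈ ℂ^{k−1}, y₂ ∈ Gr_{μ+α}; (b) the assignment v·y := π(x_{−α}(v)·y) defines a free action of the additive group (ℂ^k,+) on Φ_α^{−1}(χ_α); and (c) the map Gr_{μ+α} → Φ_α^{−1}(χ_α)/ℂ^k sending y₂ to the orbit of m(τ_α(y(0,1,0,0)), y₂) is a bijection. In particular the set-theoretic Hamiltonian reduction Φ_α^{−1}(χ_α)/ℂ^k of Gr_μ is in bijection with Gr_{μ+α}. -/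
open Matrix

noncomputable section

/-- `K = ℂ((t⁻¹))`, the field of formal Laurent series in `t⁻¹`.  We realize it as
`LaurentSeries ℂ`, where the Laurent-series variable `X` plays the role of `t⁻¹`;
thus for `f : K`, `f.coeff j` is the coefficient of `t^{-j}`. -/
abbrev K : Type := LaurentSeries ℂ

/-- The element `t` (the inverse of the Laurent series variable). -/
def tK : K := (HahnSeries.single (-1 : ℤ) (1 : ℂ))

/-- The constant embedding `ℂ → K`. -/
def Cc (z : ℂ) : K := HahnSeries.C z

/-- `f ∈ 𝒪 = ℂ[[t⁻¹]]` : no positive powers of `t`. -/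
def memO (f : K) : Prop := ∀ j : ℤ, j < 0 → f.coeff j = 0

/-- `f ∈ 𝒪₁ = t⁻¹ℂ[[t⁻¹]]`. -/
def memO1 (f : K) : Prop := ∀ j : ℤ, j ≤ 0 → f.coeff j = 0

/-- `f ∈ ℂ[t]`. -/
def memPoly (f : K) : Prop := ∀ j : ℤ, 0 < j → f.coeff j = 0

/-- Upper unitriangular matrix. -/
def IsUpperUni {R : Type*} [Zero R] [One R] {m : ℕ} (M : Matrix (Fin m) (Fin m) R) : Prop :=
  (∀ i, M i i = 1) ∧ ∀ i j : Fin m, j < i → M i j = 0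

/-- Lower unitriangular matrix. -/
def IsLowerUni {R : Type*} [Zero R] [One R] {m : ℕ} (M : Matrix (Fin m) (Fin m) R) : Prop :=
  (∀ i, M i i = 1) ∧ ∀ i j : Fin m, i < j → M i j = 0

/-- `M ∈ N₁[[t⁻¹]]` : upper unitriangular with off-diagonal entries in `𝒪₁`. -/
def MemN1 {m : ℕ} (M : Matrix (Fin m) (Fin m) K) : Prop :=
  IsUpperUni M ∧ ∀ i j : Fin m, i ≠ j → memO1 (M i j)

/-- `M ∈ N₋,₁[[t⁻¹]]`. -/
def MemN1neg {m : ℕ} (M : Matrix (Fin m) (Fin m) K) : Prop :=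
  IsLowerUni M ∧ ∀ i j : Fin m, i ≠ j → memO1 (M i j)

/-- `M ∈ T₁[[t⁻¹]]` : diagonal with entries in `1 + 𝒪₁`. -/
def MemT1 {m : ℕ} (M : Matrix (Fin m) (Fin m) K) : Prop :=
  (∀ i j : Fin m, i ≠ j → M i j = 0) ∧ ∀ i, memO1 (M i i - 1)

/-- `M ∈ N[t]` : upper unitriangular with entries in `ℂ[t]`. -/
def MemNpoly {m : ℕ} (M : Matrix (Fin m) (Fin m) K) : Prop :=
  IsUpperUni M ∧ ∀ i j : Fin m, memPoly (M i j)

/-- `M ∈ N₋[t]` : lower unitriangular with entries in `ℂ[t]`. -/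
def MemNnegPoly {m : ℕ} (M : Matrix (Fin m) (Fin m) K) : Prop :=
  IsLowerUni M ∧ ∀ i j : Fin m, memPoly (M i j)

/-- `t^ν = diag(t^{ν₁},…,t^{ν_m})`. -/
def tPow {m : ℕ} (ν : Fin m → ℤ) : Matrix (Fin m) (Fin m) K :=
  Matrix.diagonal fun i => tK ^ ν i

/-- `y = u · h · t^ν · l` is a Gauss factorization exhibiting membership in `Gr_ν`. -/
def IsGauss {m : ℕ} (ν : Fin m → ℤ) (y u h l : Matrix (Fin m) (Fin m) K) : Prop :=
  MemN1 u ∧ MemT1 h ∧ MemN1neg l ∧ y = u * h * tPow ν * l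

/-- The matrix slice `Gr_ν = N₁[[t⁻¹]]·T₁[[t⁻¹]]·t^ν·N₋,₁[[t⁻¹]]`. -/
def GrSlice {m : ℕ} (ν : Fin m → ℤ) : Set (Matrix (Fin m) (Fin m) K) :=
  { y | ∃ u h l, IsGauss ν y u h l }

/-- Block embedding `τ_α : Mat_{k+1} → Mat_n` into (1-indexed) rows and columns `r₁,…,r₁+k`,
identity outside this block. -/
def blockEmbed {R : Type*} [Zero R] [One R] (n r₁ k : ℕ)
    (g : Matrix (Fin (k+1)) (Fin (k+1)) R) : Matrix (Fin n) (Fin n) R :=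
  fun i j =>
    if h : r₁ - 1 ≤ (i : ℕ) ∧ (i : ℕ) ≤ r₁ - 1 + k ∧ r₁ - 1 ≤ (j : ℕ) ∧ (j : ℕ) ≤ r₁ - 1 + k then
      g ⟨(i : ℕ) - (r₁ - 1), by omega⟩ ⟨(j : ℕ) - (r₁ - 1), by omega⟩
    else if i = j then 1 else 0

/-- The coweight `α` of `PGL_n` : `α_{r₁} = 1`, `α_{r₂+1} = -1` (1-indexed), all other
entries `0`. -/
def alphaCo (n r₁ r₂ : ℕ) : Fin n → ℤ :=
  fun i => if (i : ℕ) = r₁ - 1 then 1 else if (i : ℕ) = r₂ then -1 else 0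

/-- The matrix `y(p,e,b,g)` (matrix representative of a point of the open Zastava
`Gr⁰_{-α}`), a `(k+1)×(k+1)` matrix over `ℂ[t] ⊆ K`. -/
def ymat (k : ℕ) (p e : ℂ) (b g : Fin (k-1) → ℂ) :
    Matrix (Fin (k+1)) (Fin (k+1)) K :=
  fun i j =>
    if _hi0 : (i : ℕ) = 0 then
      (if _hjk : (j : ℕ) = k then Cc e else 0)
    else if _hik : (i : ℕ) = k then
      (if _hj0 : (j : ℕ) = 0 then Cc (-e⁻¹)
       else if _hjk : (j : ℕ) = k then tK - Cc (p + ∑ l : Fin (k-1), b l * g l)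
       else Cc (-(g ⟨k - (j : ℕ) - 1, by have := j.isLt; omega⟩)))
    else
      (if _hji : (j : ℕ) = (i : ℕ) then 1
       else if _hjk : (j : ℕ) = k then Cc (b ⟨k - (i : ℕ) - 1, by have := i.isLt; omega⟩)
       else 0)

/-- The matrix `x₋(v)` over `K` : identity except for the bottom row `(v_k,…,v₁,1)`. -/
def xminusK (k : ℕ) (v : Fin k → ℂ) : Matrix (Fin (k+1)) (Fin (k+1)) K :=
  fun i j =>
    if _hik : (i : ℕ) = k then
      (if _hjk : (j : ℕ) = k then 1 else Cc (v ⟨k - (j : ℕ) - 1, by have := j.isLt; omega⟩))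
    else if i = j then 1 else 0

/-- `Φ_α(y)` read off from the `N₁[[t⁻¹]]`-factor `u` of a Gauss factorization of `y`. -/
def PhiOf (n r₂ k : ℕ) (hrn : r₂ < n) (u : Matrix (Fin n) (Fin n) K) : Fin k → ℂ :=
  fun a => (u ⟨r₂ - 1 - (a : ℕ), by omega⟩ ⟨r₂, hrn⟩).coeff 1

/-- `ζ_α(y)` read off from the `N₁[[t⁻¹]]`-factor `u` of a Gauss factorization of `y`. -/
def ZetaOf (n r₁ r₂ k : ℕ) (hr1 : 1 ≤ r₁) (hrr : r₁ ≤ r₂) (hrn : r₂ < n)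
    (hk : k = r₂ - r₁ + 1) (u : Matrix (Fin n) (Fin n) K) : Fin k → ℂ :=
  fun a =>
    if _ha : (a : ℕ) = k - 1 then (u ⟨r₁ - 1, by omega⟩ ⟨r₂, hrn⟩).coeff 2
    else (u ⟨r₁ - 1, by omega⟩ ⟨r₁ + (a : ℕ), by have := a.isLt; omega⟩).coeff 1

/-- `ξ_α(y)`, computed from the `N₁[[t⁻¹]]`-factor `u` of a Gauss factorization of `y`. -/
def xiOf (n r₁ r₂ k : ℕ) (hr1 : 1 ≤ r₁) (hrr : r₁ ≤ r₂) (hrn : r₂ < n)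
    (hk : k = r₂ - r₁ + 1) (u : Matrix (Fin n) (Fin n) K) : Matrix (Fin n) (Fin n) K :=
  let c := PhiOf n r₂ k hrn u
  let z := ZetaOf n r₁ r₂ k hr1 hrr hrn hk u
  let e : ℂ := c ⟨k - 1, by omega⟩
  let b : Fin (k-1) → ℂ := fun i => c ⟨(i : ℕ), by have := i.isLt; omega⟩
  let g : Fin (k-1) → ℂ := fun i => z ⟨k - (i : ℕ) - 2, by omega⟩ / e
  let p : ℂ := z ⟨k - 1, by omega⟩ / e - ∑ i : Fin (k-1), b i * g i
  blockEmbed n r₁ k (ymat k p e b g)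

/-- `M` has identity submatrix in (1-indexed) rows and columns `r₁,…,r₁+k`. -/
def HasIdBlock {R : Type*} [Zero R] [One R] {n : ℕ} (r₁ k : ℕ)
    (M : Matrix (Fin n) (Fin n) R) : Prop :=
  ∀ i j : Fin n, r₁ - 1 ≤ (i : ℕ) → (i : ℕ) ≤ r₁ - 1 + k →
    r₁ - 1 ≤ (j : ℕ) → (j : ℕ) ≤ r₁ - 1 + k →
    M i j = if i = j then 1 else 0

/-- `M ∈ N^α(K)` : upper unitriangular over `K` with identity `(k+1)×(k+1)`-block. -/
def MemNalphaK (n r₁ k : ℕ) (M : Matrix (Fin n) (Fin n) K) : Prop :=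
  IsUpperUni M ∧ HasIdBlock r₁ k M

/-- `M ∈ N^α[t]`. -/
def MemNalphaPoly (n r₁ k : ℕ) (M : Matrix (Fin n) (Fin n) K) : Prop :=
  MemNalphaK n r₁ k M ∧ ∀ i j : Fin n, memPoly (M i j)

/-- `M ∈ N(K)^α₁ = x_α(N_{1,k+1}[[t⁻¹]])·N^α(K)`. -/
def MemNKalpha1 (n r₁ k : ℕ) (M : Matrix (Fin n) (Fin n) K) : Prop :=
  ∃ (a : Matrix (Fin (k+1)) (Fin (k+1)) K) (u : Matrix (Fin n) (Fin n) K),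
    MemN1 a ∧ MemNalphaK n r₁ k u ∧ M = blockEmbed n r₁ k a * u

/-- `z = π(x)` for the slice `Gr_ν` : `z ∈ Gr_ν` and `z = a·x·b` with `a ∈ N[t]`,
`b ∈ N₋[t]`. -/
def IsPiOf {n : ℕ} (ν : Fin n → ℤ) (x z : Matrix (Fin n) (Fin n) K) : Prop :=
  z ∈ GrSlice ν ∧ ∃ a b, MemNpoly a ∧ MemNnegPoly b ∧ z = a * x * b

/-- The open Zastava slice `Gr⁰_{-α} ⊆ GL_n(K)` : matrices `τ_α(y(p,e,b,g))`. -/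
def GrZeroNegAlpha (n r₁ k : ℕ) : Set (Matrix (Fin n) (Fin n) K) :=
  { M | ∃ (p e : ℂ) (b g : Fin (k-1) → ℂ), e ≠ 0 ∧ M = blockEmbed n r₁ k (ymat k p e b g) }

/-- `μ + α`. -/
def addAlpha (n r₁ r₂ : ℕ) (μ : Fin n → ℤ) : Fin n → ℤ :=
  fun i => μ i + alphaCo n r₁ r₂ i


open Classical in
/-- `π(x)` for the slice `Gr_ν` (the element of `Gr_ν` of the form `a·x·c` with
`a ∈ N[t]`, `c ∈ N₋[t]`; it is unique when it exists). -/
noncomputable def piF {n : ℕ} (ν : Fin n → ℤ) (x : Matrix (Fin n) (Fin n) K) :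
    Matrix (Fin n) (Fin n) K :=
  if h : ∃ z, IsPiOf ν x z then h.choose else 0

open Classical in
/-- The `N₁[[t⁻¹]]`-factor of the Gauss factorization of `y ∈ Gr_ν`
(unique when it exists). -/
noncomputable def gaussUF {n : ℕ} (ν : Fin n → ℤ) (y : Matrix (Fin n) (Fin n) K) :
    Matrix (Fin n) (Fin n) K :=
  if h : ∃ u, ∃ hh l, IsGauss ν y u hh l then h.choose else 1

/-- `Φ_α : Gr_ν → ℂ^k`. -/
noncomputable def PhiF (n r₂ k : ℕ) (hrn : r₂ < n) (ν : Fin n → ℤ)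
    (y : Matrix (Fin n) (Fin n) K) : Fin k → ℂ :=
  PhiOf n r₂ k hrn (gaussUF ν y)

namespace GaussSlice

/-! ### The filtration of `K` by order in `t⁻¹`, and the subring `ℂ[t]` -/

/-- The series of order at least `d` in `t⁻¹`. -/
def fil (d : ℤ) : AddSubgroup K where
  carrier := {f | ∀ j < d, f.coeff j = 0}
  zero_mem' := by simp
  add_mem' := fun {a b} ha hb j hj => by simp [ha j hj, hb j hj]
  neg_mem' := fun {a} ha j hj => by simp [ha j hj]

lemma mem_fil {d : ℤ} {f : K} : f ∈ fil d ↔ ∀ j < d, f.coeff j = 0 := Iff.rfl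

lemma fil_mono {d e : ℤ} (h : d ≤ e) {f : K} (hf : f ∈ fil e) : f ∈ fil d :=
  fun j hj => hf j (by omega)

lemma mem_fil_iff {d : ℤ} {f : K} : f ∈ fil d ↔ (d : WithTop ℤ) ≤ f.orderTop := by
  rw [HahnSeries.le_orderTop_iff_forall]
  simp only [mem_fil, WithTop.coe_lt_coe]

lemma mul_mem_fil {d e : ℤ} {f g : K} (hf : f ∈ fil d) (hg : g ∈ fil e) :
    f * g ∈ fil (d + e) := by
  rw [mem_fil_iff] at *
  rw [HahnSeries.orderTop_mul, WithTop.coe_add]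
  exact add_le_add hf hg

lemma one_mem_fil : (1 : K) ∈ fil 0 := by
  rw [mem_fil_iff, HahnSeries.orderTop_one]; rfl

lemma memO1_iff {f : K} : memO1 f ↔ f ∈ fil 1 :=
  ⟨fun h j hj => h j (by omega), fun h j hj => h j (by omega)⟩

lemma orderTop_eq_zero {f : K} (hf : f - 1 ∈ fil 1) : f.orderTop = 0 := by
  have h0 : f ∈ fil 0 := by
    simpa using add_mem (fil_mono (by norm_num) hf) one_mem_fil
  have h1 : f.coeff 0 = 1 := by
    have := hf 0 (by norm_num)
    simpa [sub_eq_zero] using this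
  refine le_antisymm ?_ (mem_fil_iff.1 h0)
  exact HahnSeries.orderTop_le_of_coeff_ne_zero (by rw [h1]; exact one_ne_zero)

lemma ne_zero_of_sub_one_mem {f : K} (hf : f - 1 ∈ fil 1) : f ≠ 0 := by
  rintro rfl
  simpa using orderTop_eq_zero hf

lemma mem_fil_zero_of_sub_one_mem {f : K} (hf : f - 1 ∈ fil 1) : f ∈ fil 0 := by
  simpa using add_mem (fil_mono (by norm_num) hf) one_mem_fil

lemma inv_sub_one_mem {f : K} (hf : f - 1 ∈ fil 1) : f⁻¹ - 1 ∈ fil 1 := by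
  have hne := ne_zero_of_sub_one_mem hf
  have h0 : f⁻¹ ∈ fil 0 := by
    have h : f.orderTop + f⁻¹.orderTop = 0 := by
      rw [← HahnSeries.orderTop_mul, mul_inv_cancel₀ hne, HahnSeries.orderTop_one]
    rw [orderTop_eq_zero hf, zero_add] at h
    rw [mem_fil_iff, h]; rfl
  have : f⁻¹ - 1 = -(f⁻¹ * (f - 1)) := by field_simp; ring
  rw [this]
  simpa using neg_mem (mul_mem_fil h0 hf)

lemma inv_mem_fil_zero {f : K} (hf : f - 1 ∈ fil 1) : f⁻¹ ∈ fil 0 :=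
  mem_fil_zero_of_sub_one_mem (inv_sub_one_mem hf)

lemma mul_sub_one_mem {f g : K} (hf : f - 1 ∈ fil 1) (hg : g - 1 ∈ fil 1) :
    f * g - 1 ∈ fil 1 := by
  have : f * g - 1 = f * (g - 1) + (f - 1) := by ring
  rw [this]
  exact add_mem (by simpa using mul_mem_fil (mem_fil_zero_of_sub_one_mem hf) hg) hf

lemma tK_ne_zero : tK ≠ 0 := HahnSeries.single_ne_zero one_ne_zero

lemma tK_mem : tK ∈ fil (-1) := by
  intro j hj
  exact HahnSeries.coeff_single_of_ne (by omega)

lemma tK_inv : tK⁻¹ = HahnSeries.single (1 : ℤ) (1 : ℂ) := by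
  refine inv_eq_of_mul_eq_one_right ?_
  simp only [tK, HahnSeries.single_mul_single]
  simp

lemma tK_inv_mem : tK⁻¹ ∈ fil 1 := by
  rw [tK_inv]
  intro j hj
  exact HahnSeries.coeff_single_of_ne (by omega)

lemma coeff_tK_mul (f : K) (j : ℤ) : (tK * f).coeff j = f.coeff (j + 1) := by
  have := HahnSeries.coeff_single_mul_add (r := (1 : ℂ)) (x := f) (a := j + 1) (b := -1)
  simpa [tK] using this

lemma Cc_mem (z : ℂ) : Cc z ∈ fil 0 := by
  intro j hj
  exact HahnSeries.coeff_single_of_ne (by omega)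

lemma coeff_Cc_zero (z : ℂ) : (Cc z).coeff 0 = z := by
  simp [Cc, HahnSeries.C_apply]

lemma coeff_Cc_mul (z : ℂ) (f : K) (j : ℤ) : (Cc z * f).coeff j = z * f.coeff j := by
  simp [Cc]

/-- The ideal `t⁻¹ℂ[[t⁻¹]]` as a non-unital subring of `K`. -/
def maxO : NonUnitalSubring K :=
  { fil 1 with mul_mem' := fun {_ _} ha hb => fil_mono (by norm_num) (mul_mem_fil ha hb) }

lemma mem_maxO {f : K} : f ∈ maxO ↔ f ∈ fil 1 := Iff.rfl

/-- `ℂ[t]` as a non-unital subring of `K`. -/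
def poly : NonUnitalSubring K where
  carrier := {f | ∀ j : ℤ, 0 < j → f.coeff j = 0}
  zero_mem' := by simp
  add_mem' := fun {a b} ha hb j hj => by simp [ha j hj, hb j hj]
  neg_mem' := fun {a} ha j hj => by simp [ha j hj]
  mul_mem' := fun {a b} ha hb j hj => by
    rw [HahnSeries.coeff_mul]
    refine Finset.sum_eq_zero fun x hx => ?_
    rw [Finset.mem_antidiagonal] at hx
    rcases lt_or_ge 0 x.1 with h | h
    · rw [ha _ h, zero_mul]
    · rw [hb x.2 (by omega), mul_zero]

lemma mem_poly {f : K} : f ∈ poly ↔ memPoly f := Iff.rfl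

lemma one_mem_poly : (1 : K) ∈ poly := by
  intro j hj
  rw [HahnSeries.coeff_one, if_neg hj.ne']

lemma tK_mem_poly : tK ∈ poly := fun j hj => HahnSeries.coeff_single_of_ne (by omega)

lemma Cc_mem_poly (z : ℂ) : Cc z ∈ poly := fun _ hj => HahnSeries.coeff_single_of_ne hj.ne'

lemma eq_zero_of_mem_poly_of_mem_maxO {f : K} (h : f ∈ poly) (h' : f ∈ maxO) : f = 0 := by
  ext j
  rcases lt_or_ge 0 j with hj | hj
  · exact h j hj
  · exact h' j (by omega)

lemma exists_eq_poly_add_maxO (f : K) : ∃ p ∈ poly, ∃ q ∈ maxO, f = p + q := by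
  refine ⟨HahnSeries.truncLT (1 : ℤ) f, fun j hj => ?_, f - HahnSeries.truncLT (1 : ℤ) f,
    fun j hj => ?_, by ring⟩
  · exact HahnSeries.coeff_truncLT_of_le (by omega) f
  · rw [HahnSeries.coeff_sub, HahnSeries.coeff_truncLT_of_lt hj, sub_self]

/-! ### Unipotent groups attached to a grading of the index set -/

/-- `Z` raises the degree `b` by at least `d`. -/
def Raises {n : ℕ} (b : Fin n → ℤ) (d : ℤ) (Z : Matrix (Fin n) (Fin n) K) : Prop :=
  ∀ i j, b j < b i + d → Z i j = 0

lemma Raises.mono {n : ℕ} {b : Fin n → ℤ} {d e : ℤ} {Z : Matrix (Fin n) (Fin n) K}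
    (h : Raises b e Z) (hde : d ≤ e) : Raises b d Z :=
  fun i j hij => h i j (by omega)

lemma Raises.mul {n : ℕ} {b : Fin n → ℤ} {d e : ℤ} {Z W : Matrix (Fin n) (Fin n) K}
    (hZ : Raises b d Z) (hW : Raises b e W) : Raises b (d + e) (Z * W) := by
  intro i j hij
  rw [Matrix.mul_apply]
  refine Finset.sum_eq_zero fun l _ => ?_
  rcases lt_or_ge (b l) (b i + d) with h | h
  · rw [hZ i l h, zero_mul]
  · rw [hW l j (by omega), mul_zero]

lemma Raises.add {n : ℕ} {b : Fin n → ℤ} {d : ℤ} {Z W : Matrix (Fin n) (Fin n) K}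
    (hZ : Raises b d Z) (hW : Raises b d W) : Raises b d (Z + W) := by
  intro i j hij
  rw [Matrix.add_apply, hZ i j hij, hW i j hij, add_zero]

lemma Raises.neg {n : ℕ} {b : Fin n → ℤ} {d : ℤ} {Z : Matrix (Fin n) (Fin n) K}
    (hZ : Raises b d Z) : Raises b d (-Z) := by
  intro i j hij
  rw [Matrix.neg_apply, hZ i j hij, neg_zero]

lemma raises_one {n : ℕ} (b : Fin n → ℤ) : Raises b 0 (1 : Matrix (Fin n) (Fin n) K) := by
  intro i j hij
  exact Matrix.one_apply_ne (by rintro rfl; omega)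

/-- All entries of `Z` lie in `R`. -/
def EntriesIn {n : ℕ} (R : NonUnitalSubring K) (Z : Matrix (Fin n) (Fin n) K) : Prop :=
  ∀ i j, Z i j ∈ R

lemma EntriesIn.mul {n : ℕ} {R : NonUnitalSubring K} {Z W : Matrix (Fin n) (Fin n) K}
    (hZ : EntriesIn R Z) (hW : EntriesIn R W) : EntriesIn R (Z * W) := by
  intro i j
  rw [Matrix.mul_apply]
  exact sum_mem fun l _ => mul_mem (hZ i l) (hW l j)

lemma EntriesIn.add {n : ℕ} {R : NonUnitalSubring K} {Z W : Matrix (Fin n) (Fin n) K}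
    (hZ : EntriesIn R Z) (hW : EntriesIn R W) : EntriesIn R (Z + W) :=
  fun i j => add_mem (hZ i j) (hW i j)

lemma EntriesIn.neg {n : ℕ} {R : NonUnitalSubring K} {Z : Matrix (Fin n) (Fin n) K}
    (hZ : EntriesIn R Z) : EntriesIn R (-Z) :=
  fun i j => neg_mem (hZ i j)

/-- `X - 1` strictly raises the degree `b` and has entries in `R`. -/
def IsUni {n : ℕ} (b : Fin n → ℤ) (R : NonUnitalSubring K)
    (X : Matrix (Fin n) (Fin n) K) : Prop :=
  Raises b 1 (X - 1) ∧ EntriesIn R (X - 1)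

lemma isUni_one {n : ℕ} (b : Fin n → ℤ) (R : NonUnitalSubring K) :
    IsUni b R (1 : Matrix (Fin n) (Fin n) K) := by
  refine ⟨fun i j _ => by simp, fun i j => by simp [zero_mem]⟩

lemma IsUni.mul {n : ℕ} {b : Fin n → ℤ} {R : NonUnitalSubring K}
    {X Y : Matrix (Fin n) (Fin n) K} (hX : IsUni b R X) (hY : IsUni b R Y) :
    IsUni b R (X * Y) := by
  have h : X * Y - 1 = (X - 1) * (Y - 1) + ((X - 1) + (Y - 1)) := by
    simp only [mul_sub, sub_mul, mul_one, one_mul]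
    abel
  rw [IsUni, h]
  exact ⟨((hX.1.mul hY.1).mono (by norm_num)).add (hX.1.add hY.1),
    (hX.2.mul hY.2).add (hX.2.add hY.2)⟩

lemma IsUni.mono {n : ℕ} {b : Fin n → ℤ} {R S : NonUnitalSubring K} (h : R ≤ S)
    {X : Matrix (Fin n) (Fin n) K} (hX : IsUni b R X) : IsUni b S X :=
  ⟨hX.1, fun i j => h (hX.2 i j)⟩

/-- A unitriangular matrix over `R₁ + R₂` is trivialized by left and right multiplication
with unitriangular matrices over `R₁` and `R₂`. -/
lemma exists_mul_mul_eq_one {n : ℕ} (b : Fin n → ℤ) {R₁ R₂ R₃ : NonUnitalSubring K}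
    (h₁ : R₁ ≤ R₃) (h₂ : R₂ ≤ R₃) (hs : ∀ x ∈ R₃, ∃ p ∈ R₁, ∃ q ∈ R₂, x = p + q)
    {X : Matrix (Fin n) (Fin n) K} (hX : IsUni b R₃ X) :
    ∃ P Q, IsUni b R₁ P ∧ IsUni b R₂ Q ∧ P * X * Q = 1 := by
  have key : ∀ d : ℕ, ∃ P Q, IsUni b R₁ P ∧ IsUni b R₂ Q ∧
      Raises b (d + 1) (P * X * Q - 1) := by
    intro d
    induction d with
    | zero => exact ⟨1, 1, isUni_one _ _, isUni_one _ _, by simpa using hX.1⟩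
    | succ d ih =>
      obtain ⟨P, Q, hP, hQ, hd⟩ := ih
      have hY : IsUni b R₃ (P * X * Q) := ((hP.mono h₁).mul hX).mul (hQ.mono h₂)
      set Z := P * X * Q - 1 with hZ
      choose p hp q hq hpq using fun i j => hs (Z i j) (hY.2 i j)
      set A : Matrix (Fin n) (Fin n) K :=
        fun i j => if b j < b i + ((d : ℤ) + 1) then 0 else p i j
      set B : Matrix (Fin n) (Fin n) K :=
        fun i j => if b j < b i + ((d : ℤ) + 1) then 0 else q i j
      have hA : Raises b (d + 1) A := fun i j hij => if_pos hij
      have hB : Raises b (d + 1) B := fun i j hij => if_pos hij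
      have hAR : EntriesIn R₁ A := fun i j => by
        by_cases h : b j < b i + ((d : ℤ) + 1)
        · simp only [A, if_pos h, zero_mem]
        · simp only [A, if_neg h, hp]
      have hBR : EntriesIn R₂ B := fun i j => by
        by_cases h : b j < b i + ((d : ℤ) + 1)
        · simp only [B, if_pos h, zero_mem]
        · simp only [B, if_neg h, hq]
      have hAB : Z = A + B := by
        ext1 i j
        by_cases h : b j < b i + ((d : ℤ) + 1)
        · rw [Matrix.add_apply, hA i j h, hB i j h, hd i j h, add_zero]
        · rw [Matrix.add_apply, hpq]
          exact (congrArg₂ (· + ·) (if_neg h) (if_neg h)).symm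
      have uA : IsUni b R₁ (1 - A) := by
        rw [IsUni, sub_sub_cancel_left]
        exact ⟨hA.neg.mono (by omega), hAR.neg⟩
      have uB : IsUni b R₂ (1 - B) := by
        rw [IsUni, sub_sub_cancel_left]
        exact ⟨hB.neg.mono (by omega), hBR.neg⟩
      refine ⟨(1 - A) * P, Q * (1 - B), uA.mul hP, hQ.mul uB, ?_⟩
      have e : (1 - A) * P * X * (Q * (1 - B)) - 1
          = -(A * A) + -(A * B) + -(B * B) + (A * Z) * B := by
        have h1 : P * X * Q = 1 + (A + B) := by rw [← hAB, hZ]; abel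
        have h2 : (1 - A) * P * X * (Q * (1 - B)) = (1 - A) * (P * X * Q) * (1 - B) := by
          simp only [mul_assoc]
        rw [h2, h1, hAB]
        simp only [mul_sub, sub_mul, mul_one, one_mul, mul_add, add_mul]
        abel
      have hle : ((d + 1 : ℕ) : ℤ) + 1 ≤ (d + 1) + (d + 1) := by push_cast; omega
      rw [e]
      exact ((((hA.mul hA).mono hle).neg.add ((hA.mul hB).mono hle).neg).add
        ((hB.mul hB).mono hle).neg).add
        (((hA.mul hd).mul hB).mono (by push_cast; omega))
  obtain ⟨c, hc⟩ : ∃ c : ℕ, ∀ i j, b j - b i < c := by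
    obtain ⟨c, hc⟩ := (Set.finite_range fun x : Fin n × Fin n => b x.2 - b x.1).bddAbove
    refine ⟨c.toNat + 1, fun i j => ?_⟩
    have := hc ⟨(i, j), rfl⟩
    have h2 := Int.self_le_toNat c
    push_cast
    simp only at this
    omega
  obtain ⟨P, Q, hP, hQ, h⟩ := key c
  refine ⟨P, Q, hP, hQ, sub_eq_zero.1 ?_⟩
  ext1 i j
  exact h i j (by have := hc i j; omega)

lemma IsUni.exists_left_inv {n : ℕ} {b : Fin n → ℤ} {R : NonUnitalSubring K}
    {X : Matrix (Fin n) (Fin n) K} (hX : IsUni b R X) : ∃ Y, IsUni b R Y ∧ Y * X = 1 := by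
  obtain ⟨P, Q, hP, hQ, h⟩ := exists_mul_mul_eq_one b (le_refl R) (bot_le : ⊥ ≤ R)
    (fun x hx => ⟨x, hx, 0, zero_mem _, by simp⟩) hX
  have : Q = 1 := by
    rw [← sub_eq_zero]
    ext1 i j
    simpa [NonUnitalSubring.mem_bot] using hQ.2 i j
  exact ⟨P, hP, by simpa [this] using h⟩

/-- The group of matrices `X` such that `X - 1` strictly raises the degree `b` and has entries
in `R`. -/
def Uni {n : ℕ} (b : Fin n → ℤ) (R : NonUnitalSubring K) :
    Subgroup (Matrix (Fin n) (Fin n) K)ˣ where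
  carrier := {g | IsUni b R g.val}
  one_mem' := isUni_one b R
  mul_mem' := fun hx hy => hx.mul hy
  inv_mem' := fun {x} hx => by
    obtain ⟨Y, hY, h⟩ := IsUni.exists_left_inv hx
    have : x⁻¹.val = Y := Units.inv_eq_of_mul_eq_one_left h
    change IsUni b R x⁻¹.val
    rwa [this]

lemma IsUni.exists_unit {n : ℕ} {b : Fin n → ℤ} {R : NonUnitalSubring K}
    {X : Matrix (Fin n) (Fin n) K} (hX : IsUni b R X) : ∃ g ∈ Uni b R, g.val = X := by
  obtain ⟨Y, hY, h⟩ := hX.exists_left_inv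
  exact ⟨⟨X, Y, mul_eq_one_comm.1 h, h⟩, hX, rfl⟩

lemma Uni_mono {n : ℕ} (b : Fin n → ℤ) {R S : NonUnitalSubring K} (h : R ≤ S) :
    Uni b R ≤ Uni b S := fun _ hg => IsUni.mono h hg

lemma Uni.exists_factor {n : ℕ} (b : Fin n → ℤ) {R₁ R₂ : NonUnitalSubring K}
    (hs : ∀ x, ∃ p ∈ R₁, ∃ q ∈ R₂, x = p + q)
    {g : (Matrix (Fin n) (Fin n) K)ˣ} (hg : g ∈ Uni b ⊤) :
    ∃ p ∈ Uni b R₁, ∃ q ∈ Uni b R₂, p * g = q := by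
  obtain ⟨P, Q, hP, hQ, h⟩ := exists_mul_mul_eq_one b le_top le_top (fun x _ => hs x) hg
  obtain ⟨p, hp, rfl⟩ := hP.exists_unit
  obtain ⟨q, hq, rfl⟩ := hQ.exists_unit
  refine ⟨p, hp, q⁻¹, inv_mem hq, ?_⟩
  rw [eq_inv_iff_mul_eq_one]
  exact Units.ext h

lemma Uni.eq_one_of_mem {n : ℕ} {b c : Fin n → ℤ}
    {g : (Matrix (Fin n) (Fin n) K)ˣ} (hg : g ∈ Uni b poly) (hg' : g ∈ Uni c maxO) : g = 1 := by
  refine Units.ext (sub_eq_zero.1 ?_)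
  ext1 i j
  exact eq_zero_of_mem_poly_of_mem_maxO (hg.2 i j) (hg'.2 i j)

/-! ### Gauss factorizations in `GL_n(K)` -/

/-- The grading of `Fin n` defining upper unitriangular matrices. -/
def up (n : ℕ) : Fin n → ℤ := fun i => (i : ℕ)

/-- The grading of `Fin n` defining lower unitriangular matrices. -/
def dn (n : ℕ) : Fin n → ℤ := fun i => -((i : ℕ) : ℤ)

/-- Invertible diagonal matrices. -/
def dg {n : ℕ} : (Fin n → Kˣ) →* (Matrix (Fin n) (Fin n) K)ˣ :=
  (Units.map (Matrix.diagonalRingHom (Fin n) K).toMonoidHom).comp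
    (MulEquiv.piUnits (M := fun _ : Fin n => K)).symm.toMonoidHom

lemma dg_val {n : ℕ} (d : Fin n → Kˣ) :
    (dg d).val = Matrix.diagonal fun i => (d i : K) := rfl

lemma dg_conj_mem {n : ℕ} (b : Fin n → ℤ) (d : Fin n → Kˣ)
    {g : (Matrix (Fin n) (Fin n) K)ˣ} (hg : g ∈ Uni b ⊤) :
    dg d * g * (dg d)⁻¹ ∈ Uni b ⊤ := by
  refine ⟨fun i j hij => ?_, fun i j => trivial⟩
  have h : (dg d * g * (dg d)⁻¹).val - 1 = (dg d).val * (g.val - 1) * (dg d)⁻¹.val := by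
    rw [mul_sub, sub_mul, mul_one, Units.mul_inv]
    rfl
  rw [h, ← map_inv, dg_val, dg_val, Matrix.mul_diagonal, Matrix.diagonal_mul, hg.1 i j hij]
  simp

lemma gauss_unique {n : ℕ} {u u' l l' : (Matrix (Fin n) (Fin n) K)ˣ} {d d' : Fin n → Kˣ}
    (hu : u ∈ Uni (up n) ⊤) (hu' : u' ∈ Uni (up n) ⊤)
    (hl : l ∈ Uni (dn n) ⊤) (hl' : l' ∈ Uni (dn n) ⊤)
    (h : u * dg d * l = u' * dg d' * l') : u = u' ∧ l = l' := by
  have h1 : u'⁻¹ * u * dg d = dg d' * (l' * l⁻¹) := by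
    rw [← mul_right_inj u', ← mul_left_inj l]
    simpa [mul_assoc] using h
  have hX : u'⁻¹ * u ∈ Uni (up n) ⊤ := mul_mem (inv_mem hu') hu
  have hY : l' * l⁻¹ ∈ Uni (dn n) ⊤ := mul_mem hl' (inv_mem hl)
  set X := u'⁻¹ * u
  set Y := l' * l⁻¹
  have h2 : ∀ i j, X.val i j * d j = d' i * Y.val i j := by
    intro i j
    have := congrArg (fun g : (Matrix (Fin n) (Fin n) K)ˣ => g.val i j) h1
    simpa [dg_val, Matrix.mul_diagonal, Matrix.diagonal_mul] using this
  have hX1 : X = 1 := by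
    refine Units.ext (sub_eq_zero.1 ?_)
    ext1 i j
    rcases le_or_gt j i with hij | hij
    · refine hX.1 i j ?_
      have : (j : ℕ) ≤ i := hij
      simp only [up]; omega
    · have hY0 : Y.val i j = 0 := by
        have := hY.1 i j (by have : (i : ℕ) < j := hij; simp only [dn]; omega)
        rwa [Matrix.sub_apply, Matrix.one_apply_ne hij.ne, sub_zero] at this
      have := h2 i j
      rw [hY0, mul_zero] at this
      rw [Units.val_one, Matrix.sub_apply, Matrix.one_apply_ne hij.ne, sub_zero]
      exact (mul_eq_zero.1 this).resolve_right (d j).ne_zero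
  have hY1 : Y = 1 := by
    refine Units.ext (sub_eq_zero.1 ?_)
    ext1 i j
    rcases le_or_gt i j with hij | hij
    · refine hY.1 i j ?_
      have : (i : ℕ) ≤ j := hij
      simp only [dn]; omega
    · have := h2 i j
      rw [hX1, Units.val_one, Matrix.one_apply_ne hij.ne', zero_mul] at this
      rw [Units.val_one, Matrix.sub_apply, Matrix.one_apply_ne hij.ne', sub_zero]
      exact (mul_eq_zero.1 this.symm).resolve_left (d' i).ne_zero
  exact ⟨(inv_mul_eq_one.1 hX1).symm, (mul_inv_eq_one.1 hY1).symm⟩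

lemma memN1_iff {n : ℕ} {u : Matrix (Fin n) (Fin n) K} : MemN1 u ↔ IsUni (up n) maxO u := by
  constructor
  · rintro ⟨⟨h1, h2⟩, h3⟩
    have hd : ∀ i, (u - 1) i i = 0 := fun i => by simp [h1]
    refine ⟨fun i j hij => ?_, fun i j => ?_⟩
    · rcases eq_or_ne i j with rfl | hne
      · exact hd i
      · simp only [up] at hij
        have hlt : j < i := lt_of_le_of_ne (by rw [Fin.le_def]; omega) hne.symm
        simp [h2 i j hlt, hne]
    · rcases eq_or_ne i j with rfl | hne
      · rw [hd]; exact zero_mem _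
      · simpa [hne] using mem_maxO.2 (memO1_iff.1 (h3 i j hne))
  · rintro ⟨h1, h2⟩
    refine ⟨⟨fun i => ?_, fun i j hij => ?_⟩, fun i j hij => ?_⟩
    · simpa [sub_eq_zero] using h1 i i (by omega)
    · have : (j : ℕ) < i := hij
      simpa [hij.ne'] using h1 i j (by simp only [up]; omega)
    · simpa [hij] using memO1_iff.2 (h2 i j)

lemma memN1neg_iff {n : ℕ} {u : Matrix (Fin n) (Fin n) K} :
    MemN1neg u ↔ IsUni (dn n) maxO u := by
  constructor
  · rintro ⟨⟨h1, h2⟩, h3⟩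
    have hd : ∀ i, (u - 1) i i = 0 := fun i => by simp [h1]
    refine ⟨fun i j hij => ?_, fun i j => ?_⟩
    · rcases eq_or_ne i j with rfl | hne
      · exact hd i
      · simp only [dn] at hij
        have hlt : i < j := lt_of_le_of_ne (by rw [Fin.le_def]; omega) hne
        simp [h2 i j hlt, hne]
    · rcases eq_or_ne i j with rfl | hne
      · rw [hd]; exact zero_mem _
      · simpa [hne] using mem_maxO.2 (memO1_iff.1 (h3 i j hne))
  · rintro ⟨h1, h2⟩
    refine ⟨⟨fun i => ?_, fun i j hij => ?_⟩, fun i j hij => ?_⟩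
    · simpa [sub_eq_zero] using h1 i i (by omega)
    · have : (i : ℕ) < j := hij
      simpa [hij.ne] using h1 i j (by simp only [dn]; omega)
    · simpa [hij] using memO1_iff.2 (h2 i j)

lemma memNpoly_iff {n : ℕ} {u : Matrix (Fin n) (Fin n) K} :
    MemNpoly u ↔ IsUni (up n) poly u := by
  constructor
  · rintro ⟨⟨h1, h2⟩, h3⟩
    refine ⟨fun i j hij => ?_, fun i j => sub_mem (h3 i j) ?_⟩
    · rcases eq_or_ne i j with rfl | hne
      · simp [h1]
      · simp only [up] at hij
        have hlt : j < i := lt_of_le_of_ne (by rw [Fin.le_def]; omega) hne.symm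
        simp [h2 i j hlt, hne]
    · rw [Matrix.one_apply]
      split_ifs
      exacts [one_mem_poly, zero_mem _]
  · rintro ⟨h1, h2⟩
    refine ⟨⟨fun i => ?_, fun i j hij => ?_⟩, fun i j => ?_⟩
    · simpa [sub_eq_zero] using h1 i i (by omega)
    · have : (j : ℕ) < i := hij
      simpa [hij.ne'] using h1 i j (by simp only [up]; omega)
    · have h3 : (1 : Matrix (Fin n) (Fin n) K) i j ∈ poly := by
        rw [Matrix.one_apply]
        split_ifs
        exacts [one_mem_poly, zero_mem _]
      simpa using mem_poly.1 (add_mem (h2 i j) h3)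

lemma memNnegPoly_iff {n : ℕ} {u : Matrix (Fin n) (Fin n) K} :
    MemNnegPoly u ↔ IsUni (dn n) poly u := by
  constructor
  · rintro ⟨⟨h1, h2⟩, h3⟩
    refine ⟨fun i j hij => ?_, fun i j => sub_mem (h3 i j) ?_⟩
    · rcases eq_or_ne i j with rfl | hne
      · simp [h1]
      · simp only [dn] at hij
        have hlt : i < j := lt_of_le_of_ne (by rw [Fin.le_def]; omega) hne
        simp [h2 i j hlt, hne]
    · rw [Matrix.one_apply]
      split_ifs
      exacts [one_mem_poly, zero_mem _]
  · rintro ⟨h1, h2⟩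
    refine ⟨⟨fun i => ?_, fun i j hij => ?_⟩, fun i j => ?_⟩
    · simpa [sub_eq_zero] using h1 i i (by omega)
    · have : (i : ℕ) < j := hij
      simpa [hij.ne] using h1 i j (by simp only [dn]; omega)
    · have h3 : (1 : Matrix (Fin n) (Fin n) K) i j ∈ poly := by
        rw [Matrix.one_apply]
        split_ifs
        exacts [one_mem_poly, zero_mem _]
      simpa using mem_poly.1 (add_mem (h2 i j) h3)

/-- `d ∈ T₁[[t⁻¹]]·t^ν`. -/
def HasDeg {n : ℕ} (ν : Fin n → ℤ) (d : Fin n → Kˣ) : Prop :=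
  ∀ i, (d i : K) * tK ^ (-ν i) - 1 ∈ fil 1

lemma HasDeg.mul {n : ℕ} {ν ν' : Fin n → ℤ} {d d' : Fin n → Kˣ} (h : HasDeg ν d)
    (h' : HasDeg ν' d') : HasDeg (fun i => ν i + ν' i) (d * d') := by
  intro i
  have := mul_sub_one_mem (h i) (h' i)
  have e : ((d * d') i : K) * tK ^ (-(ν i + ν' i))
      = (d i : K) * tK ^ (-ν i) * ((d' i : K) * tK ^ (-ν' i)) := by
    rw [neg_add, zpow_add₀ tK_ne_zero, Pi.mul_apply, Units.val_mul]
    ring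
  rwa [e]

/-- `y = u·d·l` is a Gauss factorization, in `GL_n(K)`, of an element of `Gr_ν`. -/
structure Gauss {n : ℕ} (ν : Fin n → ℤ) (y u : (Matrix (Fin n) (Fin n) K)ˣ) (d : Fin n → Kˣ)
    (l : (Matrix (Fin n) (Fin n) K)ˣ) : Prop where
  hu : u ∈ Uni (up n) maxO
  hd : HasDeg ν d
  hl : l ∈ Uni (dn n) maxO
  eq : y = u * dg d * l

lemma isGauss_iff {n : ℕ} {ν : Fin n → ℤ} {y u : Matrix (Fin n) (Fin n) K} :
    (∃ h l, IsGauss ν y u h l) ↔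
      ∃ y' u' d l', Gauss ν y' u' d l' ∧ y = y'.val ∧ u = u'.val := by
  constructor
  · rintro ⟨h, l, hu, ⟨hT, hT1⟩, hl, rfl⟩
    obtain ⟨u, hu', rfl⟩ := (memN1_iff.1 hu).exists_unit
    obtain ⟨l, hl', rfl⟩ := (memN1neg_iff.1 hl).exists_unit
    have hT1 : ∀ i, h i i - 1 ∈ fil 1 := fun i => memO1_iff.1 (hT1 i)
    have hne := fun i => ne_zero_of_sub_one_mem (hT1 i)
    have hh : h = Matrix.diagonal fun i => h i i := by
      ext1 i j
      rcases eq_or_ne i j with rfl | hij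
      · simp
      · rw [hT i j hij, Matrix.diagonal_apply_ne _ hij]
    set d : Fin n → Kˣ := fun i =>
      Units.mk0 (h i i * tK ^ ν i) (mul_ne_zero (hne i) (zpow_ne_zero _ tK_ne_zero))
    refine ⟨_, u, d, l, ⟨hu', fun i => ?_, hl', rfl⟩, ?_, rfl⟩
    · have : (d i : K) * tK ^ (-ν i) = h i i := by
        simp only [d, Units.val_mk0]
        rw [mul_assoc, ← zpow_add₀ tK_ne_zero, add_neg_cancel, zpow_zero, mul_one]
      rw [this]
      exact hT1 i
    · simp only [Units.val_mul, dg_val]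
      rw [mul_assoc u.val h]
      congr 2
      rw [hh, tPow, Matrix.diagonal_mul_diagonal]
      simp [d]
  · rintro ⟨y', u', d, l', ⟨hu, hd, hl, rfl⟩, rfl, rfl⟩
    refine ⟨Matrix.diagonal fun i => d i * tK ^ (-ν i), l'.val, memN1_iff.2 hu,
      ⟨fun i j hij => Matrix.diagonal_apply_ne _ hij, fun i => ?_⟩, memN1neg_iff.2 hl, ?_⟩
    · rw [Matrix.diagonal_apply_eq]
      exact memO1_iff.2 (hd i)
    · simp only [Units.val_mul, dg_val]
      rw [mul_assoc u'.val (Matrix.diagonal _) (tPow ν), tPow, Matrix.diagonal_mul_diagonal]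
      congr 4
      funext i
      rw [mul_assoc, ← zpow_add₀ tK_ne_zero, neg_add_cancel, zpow_zero, mul_one]

lemma mem_GrSlice_iff {n : ℕ} {ν : Fin n → ℤ} {y : Matrix (Fin n) (Fin n) K} :
    y ∈ GrSlice ν ↔ ∃ y' u d l, Gauss ν y' u d l ∧ y = y'.val := by
  constructor
  · rintro ⟨u, hu⟩
    obtain ⟨y', u', d, l, h, h1, -⟩ := isGauss_iff.1 hu
    exact ⟨y', u', d, l, h, h1⟩
  · rintro ⟨y', u, d, l, h, rfl⟩
    exact ⟨u.val, isGauss_iff.2 ⟨y', u, d, l, h, rfl, rfl⟩⟩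

lemma Gauss.mem {n : ℕ} {ν : Fin n → ℤ} {y u l : (Matrix (Fin n) (Fin n) K)ˣ} {d : Fin n → Kˣ}
    (h : Gauss ν y u d l) : y.val ∈ GrSlice ν :=
  mem_GrSlice_iff.2 ⟨y, u, d, l, h, rfl⟩

lemma Gauss.gaussUF_eq {n : ℕ} {ν : Fin n → ℤ} {y u l : (Matrix (Fin n) (Fin n) K)ˣ}
    {d : Fin n → Kˣ} (h : Gauss ν y u d l) : gaussUF ν y.val = u.val := by
  have hex : ∃ u, ∃ hh l, IsGauss ν y.val u hh l :=
    ⟨u.val, isGauss_iff.2 ⟨y, u, d, l, h, rfl, rfl⟩⟩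
  rw [gaussUF, dif_pos hex]
  obtain ⟨y', u', d', l', h', h1, h2⟩ := isGauss_iff.1 hex.choose_spec
  rw [h2]
  have hy : y = y' := Units.ext h1
  have := h.eq.symm.trans (hy.trans h'.eq)
  rw [(gauss_unique (Uni_mono _ le_top h.hu) (Uni_mono _ le_top h'.hu)
    (Uni_mono _ le_top h.hl) (Uni_mono _ le_top h'.hl) this).1]

/-- If two elements of `Gr_ν` are related to `x` by polynomial unitriangular factors, then the
factors agree. -/
lemma polyFactor_unique {n : ℕ} {ν : Fin n → ℤ} {x z z' a a' b b' : (Matrix (Fin n) (Fin n) K)ˣ}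
    (hz : z.val ∈ GrSlice ν) (hz' : z'.val ∈ GrSlice ν)
    (ha : a ∈ Uni (up n) poly) (ha' : a' ∈ Uni (up n) poly)
    (hb : b ∈ Uni (dn n) poly) (hb' : b' ∈ Uni (dn n) poly)
    (h : z = a * x * b) (h' : z' = a' * x * b') : a = a' ∧ z = z' := by
  obtain ⟨y, u, d, l, g, e⟩ := mem_GrSlice_iff.1 hz
  obtain ⟨y', u', d', l', g', e'⟩ := mem_GrSlice_iff.1 hz'
  obtain rfl : z = y := Units.ext e
  obtain rfl : z' = y' := Units.ext e'
  have hA := mul_mem ha' (inv_mem ha)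
  have hB := mul_mem (inv_mem hb) hb'
  have key : (a' * a⁻¹ * u) * dg d * (l * (b⁻¹ * b')) = u' * dg d' * l' := by
    rw [← g'.eq, h']
    have : x = a⁻¹ * z * b⁻¹ := by rw [h]; group
    rw [this, g.eq]
    group
  obtain ⟨h1, h2⟩ := gauss_unique
    (mul_mem (Uni_mono _ le_top hA) (Uni_mono _ le_top g.hu)) (Uni_mono _ le_top g'.hu)
    (mul_mem (Uni_mono _ le_top g.hl) (Uni_mono _ le_top hB)) (Uni_mono _ le_top g'.hl) key
  have hA1 : a' * a⁻¹ = 1 := Uni.eq_one_of_mem hA (c := up n) <| by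
    rw [eq_mul_inv_of_mul_eq h1]
    exact mul_mem g'.hu (inv_mem g.hu)
  have hB1 : b⁻¹ * b' = 1 := Uni.eq_one_of_mem hB (c := dn n) <| by
    rw [eq_inv_mul_of_mul_eq h2]
    exact mul_mem (inv_mem g.hl) g'.hl
  have ea := mul_inv_eq_one.1 hA1
  have eb := inv_mul_eq_one.1 hB1
  exact ⟨ea.symm, by rw [h, h', ea, eb]⟩

lemma piF_eq {n : ℕ} {ν : Fin n → ℤ} {x z a b : (Matrix (Fin n) (Fin n) K)ˣ}
    (hz : z.val ∈ GrSlice ν) (ha : a ∈ Uni (up n) poly) (hb : b ∈ Uni (dn n) poly)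
    (h : z = a * x * b) : piF ν x.val = z.val := by
  have hex : ∃ z, IsPiOf ν x.val z :=
    ⟨z.val, hz, a.val, b.val, memNpoly_iff.2 ha, memNnegPoly_iff.2 hb, by rw [h]; rfl⟩
  rw [piF, dif_pos hex]
  obtain ⟨hz', a', b', ha', hb', h'⟩ := hex.choose_spec
  obtain ⟨a', ha₁, rfl⟩ := (memNpoly_iff.1 ha').exists_unit
  obtain ⟨b', hb₁, rfl⟩ := (memNnegPoly_iff.1 hb').exists_unit
  have e : hex.choose = (a' * x * b').val := h'
  rw [e] at hz' ⊢
  rw [(polyFactor_unique hz hz' ha ha₁ hb hb₁ h rfl).2]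

/-! ### The block embedding and its unipotent radical -/

section Block

variable {n r₁ k : ℕ}

/-- The inclusion of the block of indices of `blockEmbed n r₁ k`. -/
def blk (h : r₁ - 1 + k < n) (i : Fin (k + 1)) : Fin n := ⟨r₁ - 1 + i, by omega⟩

lemma blk_injective (h : r₁ - 1 + k < n) : Function.Injective (blk h) := by
  intro i j hij
  simp only [blk, Fin.mk.injEq] at hij
  exact Fin.ext (by omega)

lemma mem_range_blk (h : r₁ - 1 + k < n) {i : Fin n} :
    i ∈ Set.range (blk h) ↔ r₁ - 1 ≤ (i : ℕ) ∧ (i : ℕ) ≤ r₁ - 1 + k := by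
  constructor
  · rintro ⟨j, rfl⟩
    simp only [blk]; omega
  · rintro ⟨h1, h2⟩
    exact ⟨⟨i - (r₁ - 1), by omega⟩, Fin.ext (by simp only [blk]; omega)⟩

lemma blockEmbed_blk (h : r₁ - 1 + k < n) (g : Matrix (Fin (k + 1)) (Fin (k + 1)) K)
    (i j : Fin (k + 1)) : blockEmbed n r₁ k g (blk h i) (blk h j) = g i j := by
  rw [blockEmbed, dif_pos (by simp only [blk]; omega)]
  congr 1 <;> exact Fin.ext (by simp [blk])

lemma blockEmbed_out (h : r₁ - 1 + k < n) (g : Matrix (Fin (k + 1)) (Fin (k + 1)) K)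
    {i j : Fin n} (hij : ¬(i ∈ Set.range (blk h) ∧ j ∈ Set.range (blk h))) :
    blockEmbed n r₁ k g i j = (1 : Matrix (Fin n) (Fin n) K) i j := by
  rw [mem_range_blk, mem_range_blk] at hij
  rw [blockEmbed, dif_neg (by tauto), Matrix.one_apply]

/-- `blockEmbed` as a monoid homomorphism. -/
def blockHom (h : r₁ - 1 + k < n) :
    Matrix (Fin (k + 1)) (Fin (k + 1)) K →* Matrix (Fin n) (Fin n) K where
  toFun := blockEmbed n r₁ k
  map_one' := by
    ext1 i j
    by_cases hij : i ∈ Set.range (blk h) ∧ j ∈ Set.range (blk h)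
    · obtain ⟨⟨i, rfl⟩, ⟨j, rfl⟩⟩ := hij
      rw [blockEmbed_blk, Matrix.one_apply, Matrix.one_apply]
      simp only [(blk_injective h).eq_iff]
    · exact blockEmbed_out h _ hij
  map_mul' := fun x y => by
    ext1 i j
    rw [Matrix.mul_apply]
    by_cases hi : i ∈ Set.range (blk h)
    · obtain ⟨i, rfl⟩ := hi
      by_cases hj : j ∈ Set.range (blk h)
      · obtain ⟨j, rfl⟩ := hj
        rw [blockEmbed_blk, Matrix.mul_apply]
        refine Fintype.sum_of_injective (blk h) (blk_injective h) _ _ (fun l hl => ?_)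
          (fun l => ?_)
        · rw [blockEmbed_out h x (fun H => hl H.2), Matrix.one_apply_ne, zero_mul]
          rintro rfl
          exact hl ⟨i, rfl⟩
        · rw [blockEmbed_blk, blockEmbed_blk]
      · rw [blockEmbed_out h _ (fun H => hj H.2), Finset.sum_eq_single j]
        · rw [blockEmbed_out h x (fun H => hj H.2), blockEmbed_out h y (fun H => hj H.2)]
          simp
        · intro l _ hl
          rw [blockEmbed_out h y (fun H => hj H.2), Matrix.one_apply_ne hl, mul_zero]
        · simp
    · rw [blockEmbed_out h _ (fun H => hi H.1), Finset.sum_eq_single i]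
      · rw [blockEmbed_out h x (fun H => hi H.1), blockEmbed_out h y (fun H => hi H.1)]
        simp
      · intro l _ hl
        rw [blockEmbed_out h x (fun H => hi H.1), Matrix.one_apply_ne hl.symm, zero_mul]
      · simp

/-- `blockEmbed` on invertible matrices. -/
def tau (h : r₁ - 1 + k < n) :
    (Matrix (Fin (k + 1)) (Fin (k + 1)) K)ˣ →* (Matrix (Fin n) (Fin n) K)ˣ :=
  Units.map (blockHom h)

lemma tau_val (h : r₁ - 1 + k < n) (g : (Matrix (Fin (k + 1)) (Fin (k + 1)) K)ˣ) :
    (tau h g).val = blockEmbed n r₁ k g.val := rfl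

/-- The grading of `Fin n` that collapses the block to a point. -/
def cl (n r₁ k : ℕ) : Fin n → ℤ := fun i =>
  if r₁ - 1 ≤ (i : ℕ) ∧ (i : ℕ) ≤ r₁ - 1 + k then ((r₁ - 1 : ℕ) : ℤ) else (i : ℕ)

lemma cl_blk (h : r₁ - 1 + k < n) (i : Fin (k + 1)) :
    cl n r₁ k (blk h i) = ((r₁ - 1 : ℕ) : ℤ) :=
  if_pos ((mem_range_blk h).1 ⟨i, rfl⟩)

lemma cl_mono {i j : Fin n} (hij : (i : ℕ) ≤ j) : cl n r₁ k i ≤ cl n r₁ k j := by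
  unfold cl
  split_ifs <;> omega

lemma lt_of_cl_lt {i j : Fin n} (hij : cl n r₁ k i < cl n r₁ k j) : (i : ℕ) < j := by
  by_contra hc
  have := cl_mono (r₁ := r₁) (k := k) (not_lt.1 hc)
  omega

lemma eq_of_cl_eq (h : r₁ - 1 + k < n) {i j : Fin n} (hij : cl n r₁ k i = cl n r₁ k j)
    (hn : ¬(i ∈ Set.range (blk h) ∧ j ∈ Set.range (blk h))) : i = j := by
  rw [mem_range_blk, mem_range_blk] at hn
  unfold cl at hij
  apply Fin.ext
  split_ifs at hij <;> omega

lemma Uni_cl_le (R : NonUnitalSubring K) : Uni (cl n r₁ k) R ≤ Uni (up n) R := by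
  refine fun g hg => ⟨fun i j hij => hg.1 i j ?_, hg.2⟩
  have := cl_mono (n := n) (r₁ := r₁) (k := k) (i := j) (j := i) (by simp only [up] at hij; omega)
  omega

lemma raises_tau (h : r₁ - 1 + k < n) (g : (Matrix (Fin (k + 1)) (Fin (k + 1)) K)ˣ) :
    Raises (cl n r₁ k) 0 (tau h g).val := by
  intro i j hij
  rw [tau_val, blockEmbed_out h]
  · exact raises_one _ i j hij
  · rintro ⟨⟨i, rfl⟩, ⟨j, rfl⟩⟩
    rw [cl_blk, cl_blk] at hij
    omega

lemma entriesIn_tau (h : r₁ - 1 + k < n) {R : NonUnitalSubring K} (h1 : (1 : K) ∈ R)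
    {g : (Matrix (Fin (k + 1)) (Fin (k + 1)) K)ˣ} (hg : EntriesIn R g.val) :
    EntriesIn R (tau h g).val := by
  intro i j
  rw [tau_val]
  by_cases hij : i ∈ Set.range (blk h) ∧ j ∈ Set.range (blk h)
  · obtain ⟨⟨i, rfl⟩, ⟨j, rfl⟩⟩ := hij
    rw [blockEmbed_blk]
    exact hg i j
  · rw [blockEmbed_out h _ hij, Matrix.one_apply]
    split_ifs
    exacts [h1, zero_mem _]

lemma tau_conj_mem (h : r₁ - 1 + k < n) {R : NonUnitalSubring K} (h1 : (1 : K) ∈ R)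
    {c : (Matrix (Fin (k + 1)) (Fin (k + 1)) K)ˣ} (hc : EntriesIn R c.val)
    (hc' : EntriesIn R c⁻¹.val) {g : (Matrix (Fin n) (Fin n) K)ˣ}
    (hg : g ∈ Uni (cl n r₁ k) R) : tau h c * g * (tau h c)⁻¹ ∈ Uni (cl n r₁ k) R := by
  have e : (tau h c * g * (tau h c)⁻¹).val - 1
      = (tau h c).val * (g.val - 1) * (tau h c⁻¹).val := by
    rw [mul_sub, sub_mul, mul_one, map_inv, Units.mul_inv]
    rfl
  change IsUni _ _ _
  rw [IsUni, e]
  refine ⟨?_, ((entriesIn_tau h h1 hc).mul hg.2).mul (entriesIn_tau h h1 hc')⟩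
  simpa using ((raises_tau h c).mul hg.1).mul (raises_tau h c⁻¹)

lemma isUni_blockEmbed (h : r₁ - 1 + k < n) {R : NonUnitalSubring K}
    {b : Fin n → ℤ} {b' : Fin (k + 1) → ℤ}
    (hb : ∀ i j, b (blk h j) - b (blk h i) = b' j - b' i)
    {g : Matrix (Fin (k + 1)) (Fin (k + 1)) K} (hg : IsUni b' R g) :
    IsUni b R (blockEmbed n r₁ k g) := by
  have key : ∀ i j, (blockEmbed n r₁ k g - 1) (blk h i) (blk h j) = (g - 1) i j := by
    intro i j
    rw [Matrix.sub_apply, Matrix.sub_apply, blockEmbed_blk, Matrix.one_apply, Matrix.one_apply]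
    simp only [(blk_injective h).eq_iff]
  have key' : ∀ i j, ¬(i ∈ Set.range (blk h) ∧ j ∈ Set.range (blk h)) →
      (blockEmbed n r₁ k g - 1) i j = 0 := fun i j hij => by
    rw [Matrix.sub_apply, blockEmbed_out h _ hij, sub_self]
  constructor
  · intro i j hij
    by_cases H : i ∈ Set.range (blk h) ∧ j ∈ Set.range (blk h)
    · obtain ⟨⟨i, rfl⟩, ⟨j, rfl⟩⟩ := H
      rw [key]
      exact hg.1 i j (by have := hb i j; omega)
    · exact key' i j H
  · intro i j
    by_cases H : i ∈ Set.range (blk h) ∧ j ∈ Set.range (blk h)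
    · obtain ⟨⟨i, rfl⟩, ⟨j, rfl⟩⟩ := H
      rw [key]
      exact hg.2 i j
    · rw [key' i j H]
      exact zero_mem _

lemma tau_mem_up (h : r₁ - 1 + k < n) {R : NonUnitalSubring K}
    {g : (Matrix (Fin (k + 1)) (Fin (k + 1)) K)ˣ} (hg : g ∈ Uni (up (k + 1)) R) :
    tau h g ∈ Uni (up n) R :=
  isUni_blockEmbed h (fun i j => by simp [up, blk]) hg

lemma tau_mem_dn (h : r₁ - 1 + k < n) {R : NonUnitalSubring K}
    {g : (Matrix (Fin (k + 1)) (Fin (k + 1)) K)ˣ} (hg : g ∈ Uni (dn (k + 1)) R) :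
    tau h g ∈ Uni (dn n) R :=
  isUni_blockEmbed h (fun i j => by simp [dn, blk]) hg

lemma mul_tau_blk (h : r₁ - 1 + k < n) {R : NonUnitalSubring K}
    {g : (Matrix (Fin n) (Fin n) K)ˣ} (hg : g ∈ Uni (cl n r₁ k) R)
    (c : (Matrix (Fin (k + 1)) (Fin (k + 1)) K)ˣ) (i j : Fin (k + 1)) :
    (g * tau h c).val (blk h i) (blk h j) = c.val i j := by
  have e : (g * tau h c).val = (g.val - 1) * (tau h c).val + (tau h c).val := by
    rw [sub_mul, one_mul, sub_add_cancel]; rfl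
  rw [e, Matrix.add_apply, (hg.1.mul (raises_tau h c)) _ _ (by rw [cl_blk, cl_blk]; omega),
    tau_val, blockEmbed_blk, zero_add]

lemma eq_one_of_tau_mem (h : r₁ - 1 + k < n) {R : NonUnitalSubring K}
    {c : (Matrix (Fin (k + 1)) (Fin (k + 1)) K)ˣ} (hc : tau h c ∈ Uni (cl n r₁ k) R) :
    c = 1 := by
  refine Units.ext ?_
  ext1 i j
  have := mul_tau_blk h (inv_mem hc) c i j
  rw [inv_mul_cancel, Units.val_one, Matrix.one_apply] at this
  rw [← this, Units.val_one, Matrix.one_apply]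
  simp only [(blk_injective h).eq_iff]

/-- The block of a unitriangular matrix, with its complement in the unipotent radical. -/
lemma exists_block (h : r₁ - 1 + k < n) {R : NonUnitalSubring K}
    {u : (Matrix (Fin n) (Fin n) K)ˣ} (hu : u ∈ Uni (up n) R) :
    ∃ a ∈ Uni (up (k + 1)) R, (∀ i j, a.val i j = u.val (blk h i) (blk h j)) ∧
      (tau h a)⁻¹ * u ∈ Uni (cl n r₁ k) ⊤ := by
  have hA : IsUni (up (k + 1)) R (u.val.submatrix (blk h) (blk h)) := by
    have key : ∀ i j, (u.val.submatrix (blk h) (blk h) - 1) i j =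
        (u.val - 1) (blk h i) (blk h j) := by
      intro i j
      rw [Matrix.sub_apply, Matrix.submatrix_apply, Matrix.sub_apply, Matrix.one_apply, Matrix.one_apply]
      simp only [(blk_injective h).eq_iff]
    refine ⟨fun i j hij => ?_, fun i j => ?_⟩
    · rw [key]
      exact hu.1 _ _ (by simp only [up, blk] at hij ⊢; push_cast; omega)
    · rw [key]
      exact hu.2 _ _
  obtain ⟨a, ha, hval⟩ := hA.exists_unit
  have hval' : ∀ i j, a.val i j = u.val (blk h i) (blk h j) := fun i j => by
    rw [hval, Matrix.submatrix_apply]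
  refine ⟨a, ha, hval', ?_, fun i j => trivial⟩
  have e : ((tau h a)⁻¹ * u).val - 1 = (tau h a⁻¹).val * (u.val - (tau h a).val) := by
    rw [mul_sub, map_inv, Units.inv_mul]; rfl
  rw [e]
  have hr : Raises (cl n r₁ k) 1 (u.val - (tau h a).val) := by
    intro i j hij
    by_cases H : i ∈ Set.range (blk h) ∧ j ∈ Set.range (blk h)
    · obtain ⟨⟨i, rfl⟩, ⟨j, rfl⟩⟩ := H
      rw [Matrix.sub_apply, tau_val, blockEmbed_blk, hval', sub_self]
    · rw [Matrix.sub_apply, tau_val, blockEmbed_out h _ H, ← Matrix.sub_apply]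
      refine hu.1 i j ?_
      rcases eq_or_ne (cl n r₁ k j) (cl n r₁ k i) with h2 | h2
      · rw [eq_of_cl_eq h h2 (by tauto)]
        omega
      · have := lt_of_cl_lt (lt_of_le_of_ne (by omega) h2)
        simp only [up]
        omega
  simpa using (raises_tau h a⁻¹).mul hr

lemma exists_tau_dg (h : r₁ - 1 + k < n) {β : Fin (k + 1) → ℤ} {ν : Fin n → ℤ}
    (hν : ∀ i, ν (blk h i) = β i) (hν' : ∀ i ∉ Set.range (blk h), ν i = 0)
    {d : Fin (k + 1) → Kˣ} (hd : HasDeg β d) :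
    ∃ d', HasDeg ν d' ∧ tau h (dg d) = dg d' := by
  classical
  set d' : Fin n → Kˣ := Function.extend (blk h) d 1
  have hb : ∀ i, d' (blk h i) = d i := (blk_injective h).extend_apply d 1
  have hout : ∀ i ∉ Set.range (blk h), d' i = 1 := fun i hi =>
    Function.extend_apply' _ _ _ hi
  refine ⟨d', fun i => ?_, Units.ext ?_⟩
  · by_cases hi : i ∈ Set.range (blk h)
    · obtain ⟨i, rfl⟩ := hi
      rw [hb, hν]
      exact hd i
    · rw [hout i hi, hν' i hi]
      simp [zero_mem]
  · ext1 i j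
    rw [tau_val, dg_val, dg_val]
    by_cases H : i ∈ Set.range (blk h) ∧ j ∈ Set.range (blk h)
    · obtain ⟨⟨i, rfl⟩, ⟨j, rfl⟩⟩ := H
      rw [blockEmbed_blk, Matrix.diagonal_apply, Matrix.diagonal_apply, hb]
      simp only [(blk_injective h).eq_iff]
    · rw [blockEmbed_out h _ H, Matrix.one_apply, Matrix.diagonal_apply]
      split_ifs with hij
      · rw [hout i (fun hi => H ⟨hi, hij ▸ hi⟩)]
        rfl
      · rfl

/-- Left translation of a point of `Gr_ν` by a block matrix, after normalization by `N^α[t]` and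
`N₋[t]`, is read off from a Gauss factorization inside the block. -/
lemma exists_gauss_translate (h : r₁ - 1 + k < n) {ν β' : Fin n → ℤ} {β : Fin (k + 1) → ℤ}
    (hβ : ∀ i, β' (blk h i) = β i) (hβ' : ∀ i ∉ Set.range (blk h), β' i = 0)
    {y u l : (Matrix (Fin n) (Fin n) K)ˣ} {d : Fin n → Kˣ} (g : Gauss ν y u d l)
    {a c ub lb : (Matrix (Fin (k + 1)) (Fin (k + 1)) K)ˣ} {db : Fin (k + 1) → Kˣ}
    (ha : (tau h a)⁻¹ * u ∈ Uni (cl n r₁ k) ⊤)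
    (hub : ub ∈ Uni (up (k + 1)) maxO) (hdb : HasDeg β db) (hlb : lb ∈ Uni (dn (k + 1)) ⊤)
    (hc : c * a = ub * dg db * lb) :
    ∃ p ∈ Uni (cl n r₁ k) poly, ∃ m ∈ Uni (dn n) poly, ∃ u₂ d₂ l₂,
      Gauss (fun i => ν i + β' i) (p * tau h c * y * m) u₂ d₂ l₂ ∧
        ∀ i j, u₂.val (blk h i) (blk h j) = ub.val i j := by
  obtain ⟨db', hdb', hdbe⟩ := exists_tau_dg h hβ hβ' hdb
  have hconj := tau_conj_mem h (c := c * a) (R := ⊤) trivial (fun _ _ => trivial)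
    (fun _ _ => trivial) ha
  obtain ⟨p, hp, q, hq, hpq⟩ := Uni.exists_factor _ exists_eq_poly_add_maxO hconj
  set X := (dg d)⁻¹ * tau h lb * dg d * l with hX
  have hXm : X ∈ Uni (dn n) ⊤ := by
    have := dg_conj_mem (dn n) d⁻¹ (tau_mem_dn h hlb)
    rw [map_inv, inv_inv] at this
    exact mul_mem this (Uni_mono _ le_top g.hl)
  obtain ⟨m, hm, q', hq', hmq⟩ := Uni.exists_factor _ exists_eq_poly_add_maxO (inv_mem hXm)
  refine ⟨p, hp, m⁻¹, inv_mem hm, q * tau h ub, d * db', q'⁻¹,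
    ⟨mul_mem (Uni_cl_le _ hq) (tau_mem_up h hub), g.hd.mul hdb', inv_mem hq', ?_⟩,
    mul_tau_blk h hq ub⟩
  rw [← hpq, ← hmq, hX, map_mul (dg (n := n)), ← hdbe, g.eq]
  have hc' : tau h c = tau h ub * tau h (dg db) * tau h lb * (tau h a)⁻¹ := by
    rw [eq_mul_inv_iff_mul_eq, ← map_mul, hc, map_mul, map_mul]
  have hcomm : dg d * tau h (dg db) = tau h (dg db) * dg d := by
    rw [hdbe, ← map_mul, ← map_mul]
    exact congrArg dg (funext fun i => mul_comm (d i) (db' i))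
  rw [hcomm, map_mul (tau h), hc']
  group

end Block

/-! ### Gauss factorization of matrices congruent to the identity modulo `t⁻¹` -/

lemma congr_mul {n : ℕ} {R : NonUnitalSubring K} {X Y : Matrix (Fin n) (Fin n) K}
    (hX : EntriesIn R (X - 1)) (hY : EntriesIn R (Y - 1)) : EntriesIn R (X * Y - 1) := by
  have h : X * Y - 1 = (X - 1) * (Y - 1) + ((X - 1) + (Y - 1)) := by
    simp only [mul_sub, sub_mul, mul_one, one_mul]
    abel
  rw [h]
  exact (hX.mul hY).add (hX.add hY)

lemma sub_one_diag_mem {n : ℕ} {W : Matrix (Fin n) (Fin n) K} (hW : EntriesIn maxO (W - 1))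
    (i : Fin n) : W i i - 1 ∈ fil 1 := by
  simpa using mem_maxO.1 (hW i i)

lemma offdiag_mem {n : ℕ} {W : Matrix (Fin n) (Fin n) K} (hW : EntriesIn maxO (W - 1))
    {i j : Fin n} (hij : i ≠ j) : W i j ∈ fil 1 := by
  simpa [hij] using mem_maxO.1 (hW i j)

lemma exists_gauss_of_congr_aux {n : ℕ} (s : ℕ) :
    ∀ W : Matrix (Fin n) (Fin n) K, EntriesIn maxO (W - 1) →
      (∀ i j : Fin n, i ≠ j → s ≤ max (i : ℕ) j → W i j = 0) →
      ∃ u ∈ Uni (up n) maxO, ∃ d : Fin n → Kˣ, ∃ l ∈ Uni (dn n) maxO,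
        HasDeg 0 d ∧ W = (u * dg d * l).val := by
  induction s with
  | zero =>
    intro W hW h0
    refine ⟨1, one_mem _, fun i => Units.mk0 (W i i)
      (ne_zero_of_sub_one_mem (sub_one_diag_mem hW i)), 1, one_mem _, fun i => ?_, ?_⟩
    · simpa using sub_one_diag_mem hW i
    · rw [one_mul, mul_one, dg_val]
      ext1 i j
      rcases eq_or_ne i j with rfl | hij
      · simp
      · rw [h0 i j hij (Nat.zero_le _), Matrix.diagonal_apply_ne _ hij]
  | succ s ih =>
    intro W hW h0
    rcases le_or_gt n s with hs | hs
    · exact ih W hW fun i j _ hm => by omega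
    set a : Fin n := ⟨s, hs⟩
    have hc1 := sub_one_diag_mem hW a
    have hc := ne_zero_of_sub_one_mem hc1
    set x : Fin n → K := fun i => if i < a then -(W i a * (W a a)⁻¹) else 0
    set y : Fin n → K := fun j => if j < a then -((W a a)⁻¹ * W a j) else 0
    have hx : ∀ i, x i ∈ fil 1 := fun i => by
      by_cases h : i < a
      · simp only [x, if_pos h]
        exact neg_mem (mul_mem_fil (offdiag_mem hW h.ne) (inv_mem_fil_zero hc1))
      · simp only [x, if_neg h, zero_mem]
    have hy : ∀ i, y i ∈ fil 1 := fun i => by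
      by_cases h : i < a
      · simp only [y, if_pos h]
        exact neg_mem (by simpa using mul_mem_fil (inv_mem_fil_zero hc1) (offdiag_mem hW h.ne'))
      · simp only [y, if_neg h, zero_mem]
    have hX : IsUni (up n) maxO (1 + Matrix.of fun i j => if j = a then x i else 0) := by
      rw [IsUni, add_sub_cancel_left]
      refine ⟨fun i j hij => ?_, fun i j => ?_⟩
      · simp only [up] at hij
        rw [Matrix.of_apply]
        split_ifs with hj
        · subst hj
          have : ¬ i < a := by rw [Fin.lt_def]; omega
          simp only [x, if_neg this]
        · rfl
      · rw [Matrix.of_apply]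
        split_ifs
        exacts [hx i, zero_mem _]
    have hY : IsUni (dn n) maxO (1 + Matrix.of fun i j => if i = a then y j else 0) := by
      rw [IsUni, add_sub_cancel_left]
      refine ⟨fun i j hij => ?_, fun i j => ?_⟩
      · simp only [dn] at hij
        rw [Matrix.of_apply]
        split_ifs with hi
        · subst hi
          have : ¬ j < a := by rw [Fin.lt_def]; omega
          simp only [y, if_neg this]
        · rfl
      · rw [Matrix.of_apply]
        split_ifs
        exacts [hy j, zero_mem _]
    obtain ⟨X, hXm, hXv⟩ := hX.exists_unit
    obtain ⟨Y, hYm, hYv⟩ := hY.exists_unit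
    have e1 : ∀ i j, (X.val * W) i j = W i j + x i * W a j := by
      intro i j
      rw [hXv, add_mul, one_mul, Matrix.add_apply, Matrix.mul_apply]
      simp
    have e2 : ∀ i j, (X.val * W * Y.val) i j
        = W i j + x i * W a j + (W i a + x i * W a a) * y j := by
      intro i j
      have h : (X.val * W * Y.val) i j = (X.val * W) i j + (X.val * W) i a * y j := by
        rw [hYv, mul_add, mul_one, Matrix.add_apply]
        congr 1
        rw [Matrix.mul_apply]
        simp
      rw [h, e1, e1]
    obtain ⟨u, hu, d, l, hl, hd, h⟩ := ih (X.val * W * Y.val)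
      (congr_mul (congr_mul hXm.2 hW) hYm.2) (by
        intro i j hij hm
        rw [e2]
        rcases lt_trichotomy i a with hi | hi | hi
        · have hxi : x i = -(W i a * (W a a)⁻¹) := if_pos hi
          have h1 : W i a + x i * W a a = 0 := by rw [hxi]; field_simp; ring
          rw [h1, zero_mul, add_zero]
          rcases eq_or_ne j a with rfl | hj
          · exact h1
          · have hja : (j : ℕ) ≠ s := fun H => hj (Fin.ext H)
            have hia : (i : ℕ) < s := hi
            have : s < (j : ℕ) := by omega
            rw [h0 i j hij (by omega), h0 a j (Ne.symm hj) (by omega), mul_zero, add_zero]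
        · subst hi
          have hxi : x a = 0 := if_neg (lt_irrefl _)
          rw [hxi, zero_mul, zero_mul, add_zero, add_zero]
          rcases lt_or_ge j a with hj | hj
          · have hyj : y j = -((W a a)⁻¹ * W a j) := if_pos hj
            rw [hyj]; field_simp; ring
          · have hyj : y j = 0 := if_neg (not_lt.2 hj)
            have hlt : a < j := lt_of_le_of_ne hj hij
            have : s < (j : ℕ) := hlt
            rw [hyj, mul_zero, add_zero, h0 a j hij (by omega)]
        · have hxi : x i = 0 := if_neg (not_lt.2 hi.le)
          have hia : s < (i : ℕ) := hi
          rw [hxi, h0 i j hij (by omega), h0 i a hi.ne' (by omega)]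
          simp)
    refine ⟨X⁻¹ * u, mul_mem (inv_mem hXm) hu, d, l * Y⁻¹, mul_mem hl (inv_mem hYm), hd, ?_⟩
    have e : X⁻¹ * u * dg d * (l * Y⁻¹) = X⁻¹ * (u * dg d * l) * Y⁻¹ := by group
    rw [e, Units.val_mul, Units.val_mul, ← h]
    simp [mul_assoc]

/-- A matrix congruent to `1` modulo `t⁻¹` has a Gauss factorization over `ℂ[[t⁻¹]]`. -/
lemma exists_gauss_of_congr {n : ℕ} {W : Matrix (Fin n) (Fin n) K}
    (hW : EntriesIn maxO (W - 1)) :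
    ∃ u ∈ Uni (up n) maxO, ∃ d : Fin n → Kˣ, ∃ l ∈ Uni (dn n) maxO,
      HasDeg 0 d ∧ W = (u * dg d * l).val :=
  exists_gauss_of_congr_aux n W hW fun i j _ hm => by omega

/-- If clearing the last row of `M` by a column operation and rescaling the columns produces
a matrix congruent to `1`, then `M` has a Gauss factorization. -/
lemma exists_gauss_of_clear {k : ℕ} (M : (Matrix (Fin (k + 1)) (Fin (k + 1)) K)ˣ)
    (β : Fin (k + 1) → ℤ) (z : Fin (k + 1) → K) (hz : z (Fin.last k) = 0)
    (hW : ∀ i j, (M.val i j - M.val i (Fin.last k) * z j) * tK ^ (-β j) -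
      (1 : Matrix (Fin (k + 1)) (Fin (k + 1)) K) i j ∈ fil 1) :
    ∃ u ∈ Uni (up (k + 1)) maxO, ∃ d : Fin (k + 1) → Kˣ, ∃ l ∈ Uni (dn (k + 1)) ⊤,
      HasDeg β d ∧ M = u * dg d * l ∧ ∀ i ≠ Fin.last k,
        u.val i (Fin.last k) - M.val i (Fin.last k) * tK ^ (-β (Fin.last k)) ∈ fil 2 := by
  have hE : IsUni (dn (k + 1)) ⊤ (1 + Matrix.of fun i j : Fin (k + 1) =>
      if i = Fin.last k then -z j else 0) := by
    rw [IsUni, add_sub_cancel_left]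
    refine ⟨fun i j hij => ?_, fun i j => trivial⟩
    simp only [dn] at hij
    rw [Matrix.of_apply]
    split_ifs with hi
    · subst hi
      have : j = Fin.last k := Fin.ext (by simp only [Fin.val_last] at hij ⊢; omega)
      rw [this, hz, neg_zero]
    · rfl
  obtain ⟨E, hEm, hEv⟩ := hE.exists_unit
  set T : Fin (k + 1) → Kˣ := fun i => Units.mk0 (tK ^ β i) (zpow_ne_zero _ tK_ne_zero)
  have hWv : ∀ i j, (M * E * (dg T)⁻¹).val i j
      = (M.val i j - M.val i (Fin.last k) * z j) * tK ^ (-β j) := by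
    intro i j
    have h1 : (M * E).val i j = M.val i j - M.val i (Fin.last k) * z j := by
      rw [Units.val_mul, hEv, mul_add, mul_one, Matrix.add_apply, Matrix.mul_apply,
        Finset.sum_eq_single (Fin.last k) (fun l _ hl => by simp [hl]) (by simp),
        Matrix.of_apply, if_pos rfl]
      ring
    have h2 : ((T⁻¹) j : K) = tK ^ (-β j) := by simp [T, _root_.zpow_neg]
    rw [← map_inv, Units.val_mul, dg_val, Matrix.mul_diagonal, h1, h2]
  obtain ⟨u, hu, d, l, hl, hd, h⟩ := exists_gauss_of_congr (W := (M * E * (dg T)⁻¹).val)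
    (fun i j => by rw [Matrix.sub_apply, hWv]; exact hW i j)
  have h' : M * E * (dg T)⁻¹ = u * dg d * l := Units.ext h
  have hl' := dg_conj_mem (dn (k + 1)) T⁻¹ (Uni_mono _ le_top hl)
  rw [map_inv, inv_inv] at hl'
  refine ⟨u, hu, d * T, _, mul_mem hl' (inv_mem hEm), fun i => ?_, ?_, fun i hi => ?_⟩
  · have := hd i
    have e : ((d * T) i : K) * tK ^ (-β i) = d i := by
      simp only [Pi.mul_apply, Units.val_mul, T, Units.val_mk0]
      rw [mul_assoc, ← zpow_add₀ tK_ne_zero, add_neg_cancel, zpow_zero, mul_one]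
    rw [e]
    simpa using this
  · have : M = u * dg d * l * dg T * E⁻¹ := by rw [← h']; group
    rw [this, map_mul]
    group
  · have hlast := hWv i (Fin.last k)
    rw [hz, mul_zero, sub_zero, h', Units.val_mul, Matrix.mul_apply,
      Finset.sum_eq_single (Fin.last k)] at hlast
    · have hll : l.val (Fin.last k) (Fin.last k) = 1 := by
        simpa [sub_eq_zero] using hl.1 (Fin.last k) (Fin.last k) (by omega)
      rw [hll, mul_one, Units.val_mul, dg_val, Matrix.mul_diagonal] at hlast
      rw [← hlast]
      have hui : u.val i (Fin.last k) ∈ fil 1 := by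
        simpa [hi] using mem_maxO.1 (hu.2 i (Fin.last k))
      have hdl : (d (Fin.last k) : K) - 1 ∈ fil 1 := by simpa using hd (Fin.last k)
      have e : u.val i (Fin.last k) - u.val i (Fin.last k) * d (Fin.last k)
          = -(u.val i (Fin.last k) * (d (Fin.last k) - 1)) := by ring
      rw [e]
      exact neg_mem (mul_mem_fil hui hdl)
    · intro j _ hj
      have hlt : (j : ℕ) < k := Fin.val_lt_last hj
      have : l.val j (Fin.last k) = 0 := by
        simpa [hj] using hl.1 j (Fin.last k) (by simp only [dn, Fin.val_last]; omega)
      rw [this, mul_zero]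
    · simp

/-! ### The block matrices `x₋(v)` and `y(0,1,0,0)` -/

section Block

variable {k : ℕ}

/-- The off-diagonal part of the bottom row of `x₋(v)`. -/
def bot (v : Fin k → ℂ) (j : Fin (k + 1)) : K :=
  if h : (j : ℕ) = k then 0 else Cc (v ⟨k - (j : ℕ) - 1, by omega⟩)

lemma bot_last (v : Fin k → ℂ) : bot v (Fin.last k) = 0 := dif_pos rfl

lemma bot_add (v w : Fin k → ℂ) (j : Fin (k + 1)) : bot (v + w) j = bot v j + bot w j := by
  unfold bot
  split_ifs
  · simp
  · simp [Cc]

lemma bot_mem_fil (v : Fin k → ℂ) (j : Fin (k + 1)) : bot v j ∈ fil 0 := by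
  unfold bot
  split_ifs
  exacts [zero_mem _, Cc_mem _]

lemma bot_mem_poly (v : Fin k → ℂ) (j : Fin (k + 1)) : bot v j ∈ poly := by
  unfold bot
  split_ifs
  exacts [zero_mem _, Cc_mem_poly _]

lemma bot_injective : Function.Injective (bot (k := k)) := by
  intro v w h
  ext i
  have := congr_fun h ⟨k - i - 1, by omega⟩
  have h1 : ¬(k - (i : ℕ) - 1 = k) := by omega
  have h2 : k - (k - (i : ℕ) - 1) - 1 = i := by omega
  simp only [bot, h1, dif_neg, not_false_eq_true, h2] at this
  simpa [coeff_Cc_zero] using congr_arg (fun f : K => f.coeff 0) this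

lemma xminusK_apply (v : Fin k → ℂ) (i j : Fin (k + 1)) :
    xminusK k v i j = (1 : Matrix (Fin (k + 1)) (Fin (k + 1)) K) i j +
      if i = Fin.last k then bot v j else 0 := by
  unfold xminusK bot
  simp only [Matrix.one_apply, Fin.ext_iff, Fin.val_last]
  by_cases hi : (i : ℕ) = k
  · by_cases hj : (j : ℕ) = k
    · simp [hi, hj]
    · simp [hi, hj, Ne.symm hj]
  · simp [hi]

lemma xminusK_mul (v : Fin k → ℂ) (B : Matrix (Fin (k + 1)) (Fin (k + 1)) K)
    (i j : Fin (k + 1)) : (xminusK k v * B) i j =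
      B i j + if i = Fin.last k then ∑ l, bot v l * B l j else 0 := by
  have h : xminusK k v = 1 + Matrix.of fun i j => if i = Fin.last k then bot v j else 0 := by
    ext1 i j
    exact xminusK_apply v i j
  rw [h, add_mul, one_mul, Matrix.add_apply, Matrix.mul_apply]
  congr 1
  split_ifs with hi <;> simp [hi]

lemma xminusK_mul_xminusK (v w : Fin k → ℂ) :
    xminusK k v * xminusK k w = xminusK k (v + w) := by
  ext1 i j
  rw [xminusK_mul, xminusK_apply w i j, xminusK_apply _ i j, add_assoc]
  congr 1
  split_ifs with hi
  · rw [Finset.sum_eq_single j, xminusK_apply, Matrix.one_apply_eq, bot_add]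
    · split_ifs with hj
      · rw [hj, bot_last, bot_last]; ring
      · ring
    · intro l _ hl
      rw [xminusK_apply, Matrix.one_apply_ne hl]
      split_ifs with hl'
      · rw [hl', bot_last, zero_mul]
      · rw [add_zero, mul_zero]
    · simp
  · rw [add_zero]

lemma xminusK_zero : xminusK k 0 = (1 : Matrix (Fin (k + 1)) (Fin (k + 1)) K) := by
  ext1 i j
  have : bot (0 : Fin k → ℂ) j = 0 := by simp [bot, Cc]
  rw [xminusK_apply, this, ite_self, add_zero]

/-- `x₋(v)` as an invertible matrix. -/
def xU (v : Fin k → ℂ) : (Matrix (Fin (k + 1)) (Fin (k + 1)) K)ˣ where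
  val := xminusK k v
  inv := xminusK k (-v)
  val_inv := by rw [xminusK_mul_xminusK, add_neg_cancel, xminusK_zero]
  inv_val := by rw [xminusK_mul_xminusK, neg_add_cancel, xminusK_zero]

lemma xU_val (v : Fin k → ℂ) : (xU v).val = xminusK k v := rfl

lemma xU_inv (v : Fin k → ℂ) : (xU v)⁻¹ = xU (-v) := Units.ext rfl

lemma xU_mul (v w : Fin k → ℂ) : xU v * xU w = xU (v + w) :=
  Units.ext (xminusK_mul_xminusK v w)

lemma xU_injective : Function.Injective (xU (k := k)) := by
  intro v w h
  refine bot_injective (funext fun j => ?_)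
  have : (xU v).val (Fin.last k) j = (xU w).val (Fin.last k) j := by rw [h]
  rw [xU_val, xU_val, xminusK_apply, xminusK_apply, if_pos rfl, if_pos rfl] at this
  exact add_left_cancel this

lemma xU_entries (v : Fin k → ℂ) : EntriesIn poly (xU v).val := by
  intro i j
  rw [xU_val, xminusK_apply]
  refine add_mem ?_ ?_
  · rw [Matrix.one_apply]
    split_ifs
    exacts [one_mem_poly, zero_mem _]
  · split_ifs
    exacts [bot_mem_poly v j, zero_mem _]

/-- The inverse of `y(0,1,0,0)`. -/
def sInv (k : ℕ) : Matrix (Fin (k + 1)) (Fin (k + 1)) K := fun i j =>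
  if i = 0 then (if j = 0 then tK else if j = Fin.last k then -1 else 0)
  else if i = Fin.last k then (if j = 0 then 1 else 0)
  else if i = j then 1 else 0

lemma ymat_apply (hl : (0 : Fin (k + 1)) ≠ Fin.last k) (i j : Fin (k + 1)) :
    ymat k 0 1 0 0 i j =
      if i = 0 then (if j = Fin.last k then 1 else 0)
      else if i = Fin.last k then (if j = 0 then -1 else if j = Fin.last k then tK else 0)
      else if i = j then 1 else 0 := by
  have hl' : 0 ≠ k := fun h => hl (Fin.ext h)
  unfold ymat
  simp only [Fin.ext_iff, Fin.val_last, Fin.val_zero, eq_comm (a := (i : ℕ)) (b := (j : ℕ))]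
  split_ifs <;> simp [Cc]

lemma sum_two {a b : K} (hl : (0 : Fin (k + 1)) ≠ Fin.last k) (f : Fin (k + 1) → K) :
    ∑ l, (if l = 0 then a else if l = Fin.last k then b else 0) * f l =
      a * f 0 + b * f (Fin.last k) := by
  have h : ∀ l : Fin (k + 1), (if l = 0 then a else if l = Fin.last k then b else 0) * f l =
      (if l = 0 then a * f 0 else 0) + if l = Fin.last k then b * f (Fin.last k) else 0 := by
    intro l
    by_cases h0 : l = 0
    · subst h0
      simp [hl]
    · by_cases h1 : l = Fin.last k
      · subst h1
        simp [h0]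
      · simp [h0, h1]
  simp only [h, Finset.sum_add_distrib, Finset.sum_ite_eq', Finset.mem_univ, if_true]

lemma ymat_mul (hl : (0 : Fin (k + 1)) ≠ Fin.last k)
    (B : Matrix (Fin (k + 1)) (Fin (k + 1)) K) (i j : Fin (k + 1)) :
    (ymat k 0 1 0 0 * B) i j =
      if i = 0 then B (Fin.last k) j
      else if i = Fin.last k then -B 0 j + tK * B (Fin.last k) j else B i j := by
  rw [Matrix.mul_apply]
  simp only [ymat_apply hl]
  by_cases h0 : i = 0
  · simp [h0]
  · by_cases h1 : i = Fin.last k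
    · subst h1
      simp only [h0, if_false, if_true, sum_two hl]
      ring
    · simp [h0, h1]

lemma sInv_mul (hl : (0 : Fin (k + 1)) ≠ Fin.last k)
    (B : Matrix (Fin (k + 1)) (Fin (k + 1)) K) (i j : Fin (k + 1)) :
    (sInv k * B) i j =
      if i = 0 then tK * B 0 j - B (Fin.last k) j
      else if i = Fin.last k then B 0 j else B i j := by
  rw [Matrix.mul_apply]
  simp only [sInv]
  by_cases h0 : i = 0
  · simp only [h0, if_true, sum_two hl]
    ring
  · by_cases h1 : i = Fin.last k
    · subst h1
      simp [hl.symm]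
    · simp [h0, h1]

lemma sInv_mul_ymat (hl : (0 : Fin (k + 1)) ≠ Fin.last k) :
    sInv k * ymat k 0 1 0 0 = 1 := by
  ext1 i j
  rw [sInv_mul hl, ymat_apply hl, ymat_apply hl, ymat_apply hl, Matrix.one_apply]
  by_cases h0 : i = 0
  · subst h0
    by_cases j0 : j = 0
    · subst j0; simp [hl, hl.symm]
    · by_cases j1 : j = Fin.last k
      · subst j1; simp [hl, hl.symm]
      · simp [hl.symm, j0, j1, Ne.symm j0]
  · by_cases h1 : i = Fin.last k
    · subst h1; simp [hl.symm, eq_comm]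
    · simp [h0, h1]

/-- `y(0,1,0,0)` as an invertible matrix. -/
def sU (hl : (0 : Fin (k + 1)) ≠ Fin.last k) : (Matrix (Fin (k + 1)) (Fin (k + 1)) K)ˣ where
  val := ymat k 0 1 0 0
  inv := sInv k
  val_inv := mul_eq_one_comm.1 (sInv_mul_ymat hl)
  inv_val := sInv_mul_ymat hl

variable (hl : (0 : Fin (k + 1)) ≠ Fin.last k)

lemma sU_val : (sU hl).val = ymat k 0 1 0 0 := rfl

lemma sU_inv_val : (sU hl)⁻¹.val = sInv k := rfl

lemma sU_entries : EntriesIn poly (sU hl).val := by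
  intro i j
  rw [sU_val, ymat_apply hl]
  split_ifs
  all_goals first
    | exact one_mem_poly | exact zero_mem _ | exact tK_mem_poly | exact neg_mem one_mem_poly

lemma sU_inv_entries : EntriesIn poly (sU hl)⁻¹.val := by
  intro i j
  rw [sU_inv_val, sInv]
  split_ifs
  all_goals first
    | exact one_mem_poly | exact zero_mem _ | exact tK_mem_poly | exact neg_mem one_mem_poly

lemma xU_mul_sU_entries (v : Fin k → ℂ) : EntriesIn poly (xU v * sU hl).val :=
  (xU_entries v).mul (sU_entries hl)

lemma xU_mul_sU_inv_entries (v : Fin k → ℂ) : EntriesIn poly (xU v * sU hl)⁻¹.val := by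
  rw [_root_.mul_inv_rev, xU_inv]
  exact (sU_inv_entries hl).mul (xU_entries _)

lemma sU_conj_xU_mem (v : Fin k → ℂ) : (sU hl)⁻¹ * xU v * sU hl ∈ Uni (up (k + 1)) poly := by
  have key : ∀ i j, ((sU hl)⁻¹ * xU v * sU hl).val i j -
      (1 : Matrix (Fin (k + 1)) (Fin (k + 1)) K) i j =
      if i = 0 then -∑ l, bot v l * ymat k 0 1 0 0 l j else 0 := by
    intro i j
    have h1 : (1 : Matrix (Fin (k + 1)) (Fin (k + 1)) K) i j = (sInv k * ymat k 0 1 0 0) i j := by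
      rw [sInv_mul_ymat hl]
    rw [mul_assoc, Units.val_mul, Units.val_mul, h1, sU_inv_val, sU_val, xU_val, sInv_mul hl,
      sInv_mul hl, xminusK_mul, xminusK_mul, xminusK_mul]
    by_cases h0 : i = 0
    · simp only [h0, if_true, hl, if_false, add_zero]
      ring
    · by_cases h1 : i = Fin.last k
      · subst h1
        simp [hl, hl.symm]
      · simp [h0, h1]
  refine ⟨fun i j hij => ?_, fun i j => ?_⟩
  · rw [Matrix.sub_apply, key]
    split_ifs with hi
    · subst hi
      have hj : j = 0 := Fin.ext (by simp only [up, Fin.val_zero] at hij ⊢; omega)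
      subst hj
      rw [neg_eq_zero]
      refine Finset.sum_eq_zero fun l _ => ?_
      rw [ymat_apply hl]
      by_cases l0 : l = 0
      · simp [l0, hl]
      · by_cases l1 : l = Fin.last k
        · rw [l1, bot_last, zero_mul]
        · simp [l0, l1]
    · rfl
  · rw [Matrix.sub_apply, key]
    split_ifs
    · exact neg_mem (sum_mem fun l _ => mul_mem (bot_mem_poly v l) (sU_entries hl l j))
    · exact zero_mem _

lemma ymat_eq (p : ℂ) (g : Fin (k - 1) → ℂ) (v : Fin k → ℂ)
    (hp : ∀ i : Fin k, (i : ℕ) = k - 1 → p = -v i)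
    (hg : ∀ (i : Fin (k - 1)) (j : Fin k), (j : ℕ) = i → g i = -v j) :
    (xU v * sU hl).val = ymat k p 1 0 g := by
  have hl' : k ≠ 0 := fun h => hl (Fin.ext h.symm)
  ext1 i j
  rw [Units.val_mul, xU_val, sU_val, xminusK_mul]
  by_cases h1 : i = Fin.last k
  · rw [if_pos h1, h1]
    by_cases j0 : j = 0
    · subst j0
      rw [Finset.sum_eq_zero, add_zero]
      · simp [ymat, hl']
      · intro l _
        by_cases l1 : l = Fin.last k
        · rw [l1, bot_last, zero_mul]
        · rw [ymat_apply hl]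
          by_cases l0 : l = 0
          · simp [l0, hl]
          · simp [l0, l1]
    · have j0' : (j : ℕ) ≠ 0 := fun h => j0 (Fin.ext h)
      by_cases j1 : j = Fin.last k
      · subst j1
        rw [Finset.sum_eq_single 0]
        · rw [ymat_apply hl, ymat_apply hl, bot, dif_neg (by simpa using Ne.symm hl'),
            ← neg_neg (v _), ← hp _ (by simp)]
          simp [ymat, hl', hl.symm, Cc, sub_eq_add_neg]
        · intro l _ l0
          by_cases l1 : l = Fin.last k
          · rw [l1, bot_last, zero_mul]
          · rw [ymat_apply hl]
            simp [l0, l1]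
        · simp
      · have j1' : (j : ℕ) ≠ k := fun h => j1 (Fin.ext h)
        rw [Finset.sum_eq_single j]
        · rw [ymat_apply hl, ymat_apply hl, bot, dif_neg j1']
          simp only [hl.symm, j0, j1, if_true, if_false, zero_add, mul_one]
          have := hg ⟨k - j - 1, by omega⟩ ⟨k - j - 1, by omega⟩ rfl
          simp [ymat, hl', j0', j1', this]
        · intro l _ lj
          by_cases l1 : l = Fin.last k
          · rw [l1, bot_last, zero_mul]
          · rw [ymat_apply hl]
            by_cases l0 : l = 0
            · simp [l0, j1]
            · simp [l0, l1, lj]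
        · simp
  · rw [if_neg h1, add_zero]
    have h1' : (i : ℕ) ≠ k := fun h => h1 (Fin.ext h)
    simp [ymat, h1']

end Block

/-! ### Gauss factorization of translates of `N₁[[t⁻¹]]` by `x₋(v) y(0,1,0,0)` -/

section BlockGauss

variable {k : ℕ}

/-- The restriction of `α` to the block. -/
def alphaB (k : ℕ) (i : Fin (k + 1)) : ℤ := if i = 0 then 1 else if i = Fin.last k then -1 else 0

lemma Uni.apply_of_le {R : NonUnitalSubring K} {a : (Matrix (Fin (k + 1)) (Fin (k + 1)) K)ˣ}
    (ha : a ∈ Uni (up (k + 1)) R) {i j : Fin (k + 1)} (h : j ≤ i) :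
    a.val i j = (1 : Matrix (Fin (k + 1)) (Fin (k + 1)) K) i j :=
  sub_eq_zero.1 (ha.1 i j (by have : (j : ℕ) ≤ i := h; simp only [up]; omega))

lemma Uni.sub_one_mem {a : (Matrix (Fin (k + 1)) (Fin (k + 1)) K)ˣ}
    (ha : a ∈ Uni (up (k + 1)) maxO) (i j : Fin (k + 1)) :
    a.val i j - (1 : Matrix (Fin (k + 1)) (Fin (k + 1)) K) i j ∈ fil 1 := ha.2 i j

lemma Uni.mem_fil_zero {a : (Matrix (Fin (k + 1)) (Fin (k + 1)) K)ˣ}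
    (ha : a ∈ Uni (up (k + 1)) maxO) (i j : Fin (k + 1)) : a.val i j ∈ fil 0 := by
  have h : (1 : Matrix (Fin (k + 1)) (Fin (k + 1)) K) i j ∈ fil 0 := by
    rw [Matrix.one_apply]
    split_ifs
    exacts [one_mem_fil, zero_mem _]
  simpa using add_mem (fil_mono (by norm_num) (Uni.sub_one_mem ha i j)) h

lemma Uni.mem_fil_one {a : (Matrix (Fin (k + 1)) (Fin (k + 1)) K)ˣ}
    (ha : a ∈ Uni (up (k + 1)) maxO) {i j : Fin (k + 1)} (hij : i ≠ j) : a.val i j ∈ fil 1 := by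
  simpa [hij] using Uni.sub_one_mem ha i j

lemma fil_succ {d : ℤ} {f : K} (hf : f ∈ fil d) (h : f.coeff d = 0) : f ∈ fil (d + 1) := by
  intro j hj
  rcases eq_or_ne j d with rfl | hne
  · exact h
  · exact hf j (by omega)

lemma coeff_eq_of_sub_mem {d j : ℤ} {f g : K} (h : f - g ∈ fil d) (hj : j < d) :
    f.coeff j = g.coeff j := by
  have := h j hj
  rwa [HahnSeries.coeff_sub, sub_eq_zero] at this

lemma coeff_tK_inv_one : (tK⁻¹).coeff 1 = 1 := by
  rw [tK_inv, HahnSeries.coeff_single_same]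

variable (hl : (0 : Fin (k + 1)) ≠ Fin.last k)

lemma exists_gauss_xU_mul_sU (v : Fin k → ℂ) {a : (Matrix (Fin (k + 1)) (Fin (k + 1)) K)ˣ}
    (ha : a ∈ Uni (up (k + 1)) maxO) :
    ∃ u ∈ Uni (up (k + 1)) maxO, ∃ d : Fin (k + 1) → Kˣ, ∃ l ∈ Uni (dn (k + 1)) ⊤,
      HasDeg (fun i => -alphaB k i) d ∧ xU v * sU hl * a = u * dg d * l ∧
      ∀ i ≠ Fin.last k, (u.val i (Fin.last k)).coeff 1 = if i = 0 then 1 else 0 := by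
  set L := Fin.last k
  have hs : ∀ i j, (sU hl * a).val i j = if i = 0 then a.val L j
      else if i = L then -a.val 0 j + tK * a.val L j else a.val i j := fun i j => by
    rw [Units.val_mul, sU_val, ymat_mul hl]
  set r : Fin (k + 1) → K := fun j =>
    -a.val 0 j + tK * a.val L j + ∑ l, bot v l * (sU hl * a).val l j
  have hM : ∀ i j, (xU v * sU hl * a).val i j = if i = 0 then a.val L j
      else if i = L then r j else a.val i j := fun i j => by
    rw [mul_assoc, Units.val_mul, xU_val, xminusK_mul, hs]
    by_cases h0 : i = 0
    · rw [h0, if_pos rfl, if_pos rfl, if_neg hl, add_zero]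
    · by_cases h1 : i = Fin.last k
      · rw [if_neg h0, if_neg h0, if_pos h1, if_pos h1, if_pos h1]
      · rw [if_neg h0, if_neg h0, if_neg h1, if_neg h1, if_neg h1, add_zero]
  have hLj : ∀ j, a.val L j = if j = L then 1 else 0 := fun j => by
    rw [Uni.apply_of_le ha (Fin.le_last j), Matrix.one_apply]
    simp only [eq_comm, L]
  have hi0 : ∀ i ≠ 0, a.val i 0 = 0 := fun i hi => by
    rw [Uni.apply_of_le ha (Fin.zero_le i), Matrix.one_apply_ne hi]
  have h00 : a.val 0 0 = 1 := by rw [Uni.apply_of_le ha le_rfl, Matrix.one_apply_eq]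
  have hsum : ∀ j, ∑ l, bot v l * (sU hl * a).val l j ∈ fil 0 := fun j =>
    sum_mem fun l _ => by
      rw [hs]
      by_cases l1 : l = L
      · rw [l1, bot_last, zero_mul]
        exact zero_mem _
      · simp only [l1, if_false]
        have h : (if l = 0 then a.val L j else a.val l j) ∈ fil 0 := by
          split_ifs <;> exact Uni.mem_fil_zero ha _ _
        simpa using mul_mem_fil (bot_mem_fil v l) h
  have hr0 : r 0 = -1 := by
    simp only [r]
    rw [Finset.sum_eq_zero, h00, hi0 L hl.symm]
    · ring
    · intro l _
      rw [hs]
      by_cases l1 : l = L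
      · rw [l1, bot_last, zero_mul]
      · by_cases l0 : l = 0
        · simp [l0, hi0 L hl.symm]
        · simp [l0, l1, hi0 l l0]
  have hrj : ∀ j ≠ L, r j ∈ fil 0 := fun j hj => by
    simp only [r, hLj, hj, if_false, mul_zero, add_zero]
    exact add_mem (neg_mem (Uni.mem_fil_zero ha _ _)) (hsum j)
  have hrL : r L * tK⁻¹ - 1 ∈ fil 1 := by
    have h1 : -a.val 0 L + ∑ l, bot v l * (sU hl * a).val l L ∈ fil 0 :=
      add_mem (neg_mem (Uni.mem_fil_zero ha _ _)) (hsum L)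
    have h2 : r L * tK⁻¹ - 1
        = (-a.val 0 L + ∑ l, bot v l * (sU hl * a).val l L) * tK⁻¹ := by
      have := mul_inv_cancel₀ tK_ne_zero
      simp only [r, hLj, if_true, mul_one]
      linear_combination this
    rw [h2]
    simpa using mul_mem_fil h1 tK_inv_mem
  have hne := ne_zero_of_sub_one_mem hrL
  have hrL0 : r L ≠ 0 := fun h => hne (by rw [h, zero_mul])
  set ω := (r L * tK⁻¹)⁻¹
  have hω : ω - 1 ∈ fil 1 := inv_sub_one_mem hrL
  have hrω : r L * tK⁻¹ * ω = 1 := mul_inv_cancel₀ hne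
  set z : Fin (k + 1) → K := fun j => if j = L then 0 else r j * (tK⁻¹ * ω)
  have hz : ∀ j, z j ∈ fil 1 := fun j => by
    simp only [z]
    split_ifs with hj
    · exact zero_mem _
    · exact mul_mem_fil (d := 0) (e := 1) (hrj j hj)
        (mul_mem_fil (d := 1) (e := 0) tK_inv_mem (mem_fil_zero_of_sub_one_mem hω))
  have htt : tK⁻¹ * tK = 1 := inv_mul_cancel₀ tK_ne_zero
  have aL : alphaB k L = -1 := by simp [alphaB, hl.symm, L]
  have a0 : alphaB k 0 = 1 := by simp [alphaB]
  obtain ⟨u, hu, d, l, hlm, hd, he, hc⟩ := exists_gauss_of_clear (xU v * sU hl * a)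
    (fun i => -alphaB k i) z (if_pos rfl) (fun i j => by
      simp only [neg_neg, hM]
      by_cases jL : j = L
      · have zL : z L = 0 := if_pos rfl
        rw [jL, zL, mul_zero, sub_zero, aL, _root_.zpow_neg, zpow_one]
        by_cases i0 : i = 0
        · rw [if_pos i0, hLj, if_pos rfl, i0, Matrix.one_apply_ne hl, one_mul, sub_zero]
          exact tK_inv_mem
        · by_cases iL : i = L
          · rw [if_neg i0, if_pos iL, iL, Matrix.one_apply_eq]
            exact hrL
          · rw [if_neg i0, if_neg iL, Matrix.one_apply_ne iL, sub_zero]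
            exact fil_mono (by norm_num) (mul_mem_fil (Uni.mem_fil_zero ha i L) tK_inv_mem)
      · have hzj : z j = r j * (tK⁻¹ * ω) := if_neg jL
        by_cases iL : i = L
        · have i0 : i ≠ 0 := fun h => hl (h.symm.trans iL)
          rw [if_neg i0, if_neg i0, if_pos iL, if_pos iL, iL, Matrix.one_apply_ne (Ne.symm jL), hzj]
          have : r j - r L * (r j * (tK⁻¹ * ω)) = 0 := by linear_combination (-r j) * hrω
          rw [this, zero_mul, sub_zero]
          exact zero_mem _
        · by_cases i0 : i = 0
          · rw [if_pos i0, if_pos i0, hLj, hLj, if_neg jL, if_pos rfl, i0]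
            by_cases j0 : j = 0
            · rw [j0, a0, zpow_one, Matrix.one_apply_eq, ← j0, hzj, j0, hr0]
              have : (0 - 1 * (-1 * (tK⁻¹ * ω))) * tK - 1 = ω - 1 := by
                linear_combination ω * htt
              rw [this]
              exact hω
            · have aj : alphaB k j = 0 := by
                rw [alphaB, if_neg j0, if_neg jL]
              rw [aj, zpow_zero, mul_one, one_mul, Matrix.one_apply_ne (Ne.symm j0), sub_zero,
                zero_sub]
              exact neg_mem (hz j)
          · rw [if_neg i0, if_neg i0, if_neg iL, if_neg iL]
            have hiL : a.val i L * z j ∈ fil 2 := mul_mem_fil (Uni.mem_fil_one ha iL) (hz j)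
            by_cases j0 : j = 0
            · rw [j0] at hiL ⊢
              rw [hi0 i i0, a0, zpow_one, Matrix.one_apply_ne i0, sub_zero, zero_sub]
              exact mul_mem_fil (d := 2) (neg_mem hiL) tK_mem
            · have aj : alphaB k j = 0 := by
                rw [alphaB, if_neg j0, if_neg jL]
              rw [aj, zpow_zero, mul_one, sub_right_comm]
              exact sub_mem (Uni.sub_one_mem ha i j) (fil_mono (by norm_num) hiL))
  refine ⟨u, hu, d, l, hlm, hd, he, fun i hi => ?_⟩
  have := hc i hi
  rw [neg_neg, aL, _root_.zpow_neg, zpow_one, hM] at this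
  rw [coeff_eq_of_sub_mem this one_lt_two]
  by_cases i0 : i = 0
  · rw [if_pos i0, if_pos i0, hLj, if_pos rfl, one_mul, coeff_tK_inv_one]
  · rw [if_neg i0, if_neg i0, if_neg hi]
    exact mul_mem_fil (Uni.mem_fil_one ha hi) tK_inv_mem 1 (by norm_num)

lemma exists_gauss_inv_xU_mul_sU {a : (Matrix (Fin (k + 1)) (Fin (k + 1)) K)ˣ}
    (ha : a ∈ Uni (up (k + 1)) maxO)
    (hc : ∀ i ≠ Fin.last k, (a.val i (Fin.last k)).coeff 1 = if i = 0 then 1 else 0) :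
    ∃ v : Fin k → ℂ, ∃ u ∈ Uni (up (k + 1)) maxO, ∃ d : Fin (k + 1) → Kˣ,
      ∃ l ∈ Uni (dn (k + 1)) ⊤,
        HasDeg (alphaB k) d ∧ (xU v * sU hl)⁻¹ * a = u * dg d * l := by
  set L := Fin.last k
  set w : Fin (k + 1) → ℂ := fun l =>
    if l = 0 then (a.val 0 L).coeff 2 else (a.val 0 l).coeff 1
  obtain ⟨v, hv⟩ : ∃ v : Fin k → ℂ, ∀ l ≠ L, bot (-v) l = Cc (w l) := by
    refine ⟨fun i => -w ⟨k - i - 1, by omega⟩, fun l hlL => ?_⟩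
    have h1 : (l : ℕ) ≠ k := fun h => hlL (Fin.ext h)
    have h2 : k - (k - (l : ℕ) - 1) - 1 = l := by omega
    rw [bot, dif_neg h1]
    simp only [Pi.neg_apply, neg_neg, h2]
  have hvL : bot (-v) L = 0 := bot_last _
  have hLj : ∀ j, a.val L j = if j = L then 1 else 0 := fun j => by
    rw [Uni.apply_of_le ha (Fin.le_last j), Matrix.one_apply]
    simp only [eq_comm, L]
  have hi0 : ∀ i ≠ 0, a.val i 0 = 0 := fun i hi => by
    rw [Uni.apply_of_le ha (Fin.zero_le i), Matrix.one_apply_ne hi]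
  have h00 : a.val 0 0 = 1 := by rw [Uni.apply_of_le ha le_rfl, Matrix.one_apply_eq]
  set q : Fin (k + 1) → K := fun j =>
    tK * a.val 0 j - (a.val L j + ∑ l, bot (-v) l * a.val l j)
  have hM : ∀ i j, ((xU v * sU hl)⁻¹ * a).val i j = if i = 0 then q j
      else if i = L then a.val 0 j else a.val i j := fun i j => by
    rw [_root_.mul_inv_rev, xU_inv, mul_assoc, Units.val_mul, sU_inv_val, Units.val_mul, xU_val,
      sInv_mul hl, xminusK_mul, xminusK_mul, xminusK_mul]
    by_cases h0 : i = 0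
    · rw [h0, if_pos rfl, if_pos rfl, if_neg hl, if_pos rfl, add_zero]
    · by_cases h1 : i = Fin.last k
      · rw [if_neg h0, if_neg h0, if_pos h1, if_pos h1, if_neg hl, add_zero]
      · rw [if_neg h0, if_neg h0, if_neg h1, if_neg h1, if_neg h1, add_zero]
  have htt : tK⁻¹ * tK = 1 := inv_mul_cancel₀ tK_ne_zero
  have hiL2 : ∀ i ≠ L, i ≠ 0 → a.val i L ∈ fil 2 := fun i hi h0 =>
    fil_succ (d := 1) (Uni.mem_fil_one ha hi) (by rw [hc i hi, if_neg h0])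
  have h0L : a.val 0 L * tK - 1 ∈ fil 1 := by
    refine fil_succ (d := 0) (sub_mem (mul_mem_fil (d := 1) (e := -1) (Uni.mem_fil_one ha hl) tK_mem)
      one_mem_fil) ?_
    rw [HahnSeries.coeff_sub, mul_comm, coeff_tK_mul, zero_add, hc 0 hl, if_pos rfl,
      HahnSeries.coeff_one, if_pos rfl, sub_self]
  have hq0 : q 0 = tK - Cc (w 0) := by
    simp only [q]
    rw [h00, hLj, if_neg hl, Finset.sum_eq_single 0, h00, hv 0 hl]
    · ring
    · intro l _ h
      rw [hi0 l h, mul_zero]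
    · simp
  have hqj : ∀ j ≠ 0, j ≠ L → q j ∈ fil 1 := fun j j0 jL => by
    have h1 : tK * a.val 0 j - Cc (w j) ∈ fil 1 := by
      refine fil_succ (d := 0) (sub_mem (mul_mem_fil (d := -1) tK_mem
        (Uni.mem_fil_one ha (Ne.symm j0))) (Cc_mem _)) ?_
      rw [HahnSeries.coeff_sub, coeff_tK_mul, coeff_Cc_zero]
      simp [w, j0]
    have h2 : ∑ l, bot (-v) l * (a.val l j - (1 : Matrix (Fin (k + 1)) (Fin (k + 1)) K) l j)
        ∈ fil 1 := sum_mem fun l _ => by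
      simpa using mul_mem_fil (bot_mem_fil (-v) l) (Uni.sub_one_mem ha l j)
    have h3 : q j = tK * a.val 0 j - Cc (w j) -
        ∑ l, bot (-v) l * (a.val l j - (1 : Matrix (Fin (k + 1)) (Fin (k + 1)) K) l j) := by
      simp only [q, mul_sub, Finset.sum_sub_distrib, hLj, if_neg jL, Matrix.one_apply, mul_ite,
        mul_one, mul_zero, Finset.sum_ite_eq', Finset.mem_univ, if_true, hv j jL]
      ring
    rw [h3]
    exact sub_mem h1 h2
  have hqL : q L ∈ fil 2 := by
    have h1 : a.val 0 L * tK - 1 - Cc (w 0) * tK⁻¹ ∈ fil 2 := by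
      refine fil_succ (d := 1) (sub_mem h0L (mul_mem_fil (d := 0) (Cc_mem _) tK_inv_mem)) ?_
      rw [HahnSeries.coeff_sub, HahnSeries.coeff_sub, mul_comm, coeff_tK_mul, coeff_Cc_mul,
        coeff_tK_inv_one, HahnSeries.coeff_one, if_neg one_ne_zero]
      simp [w]
    have h2 : ∑ l, bot (-v) l * (a.val l L - if l = 0 then tK⁻¹ else 0) ∈ fil 2 :=
      sum_mem fun l _ => by
        by_cases lL : l = L
        · rw [lL, hvL, zero_mul]
          exact zero_mem _
        · by_cases l0 : l = 0
          · have h4 : a.val 0 L - tK⁻¹ ∈ fil 2 := by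
              have := mul_mem_fil h0L tK_inv_mem
              have e : (a.val 0 L * tK - 1) * tK⁻¹ = a.val 0 L - tK⁻¹ := by
                linear_combination a.val 0 L * htt
              rwa [e] at this
            rw [if_pos l0, l0]
            simpa using mul_mem_fil (bot_mem_fil (-v) 0) h4
          · rw [if_neg l0, sub_zero]
            simpa using mul_mem_fil (bot_mem_fil (-v) l) (hiL2 l lL l0)
    have h3 : q L = a.val 0 L * tK - 1 - Cc (w 0) * tK⁻¹ -
        ∑ l, bot (-v) l * (a.val l L - if l = 0 then tK⁻¹ else 0) := by
      simp only [q, mul_sub, Finset.sum_sub_distrib, hLj, if_true, mul_ite,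
        mul_zero, Finset.sum_ite_eq', Finset.mem_univ, hv 0 hl]
      ring
    rw [h3]
    exact sub_mem h1 h2
  have hne := ne_zero_of_sub_one_mem h0L
  set ω := (a.val 0 L * tK)⁻¹
  have hω : ω ∈ fil 0 := inv_mem_fil_zero h0L
  have hrω : a.val 0 L * tK * ω = 1 := mul_inv_cancel₀ hne
  set z : Fin (k + 1) → K := fun j => if j = L then 0 else a.val 0 j * (tK * ω)
  have htω : tK * ω ∈ fil (-1) := mul_mem_fil (e := 0) tK_mem hω
  have hz0 : z 0 ∈ fil (-1) := by
    simp only [z, if_neg hl, h00, one_mul]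
    exact htω
  have hzj : ∀ j ≠ 0, j ≠ L → z j ∈ fil 0 := fun j j0 jL => by
    simp only [z, if_neg jL]
    exact mul_mem_fil (d := 1) (Uni.mem_fil_one ha (Ne.symm j0)) htω
  have aL : alphaB k L = -1 := by simp [alphaB, hl.symm, L]
  have a0 : alphaB k 0 = 1 := by simp [alphaB]
  obtain ⟨u, hu, d, l, hlm, hd, he, -⟩ := exists_gauss_of_clear ((xU v * sU hl)⁻¹ * a)
    (alphaB k) z (if_pos rfl) (fun i j => by
      simp only [hM]
      by_cases jL : j = L
      · have zL : z L = 0 := if_pos rfl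
        rw [jL, zL, mul_zero, sub_zero, aL, neg_neg, zpow_one]
        by_cases i0 : i = 0
        · rw [if_pos i0, i0, Matrix.one_apply_ne hl, sub_zero]
          exact mul_mem_fil (d := 2) hqL tK_mem
        · by_cases iL : i = L
          · rw [if_neg i0, if_pos iL, iL, Matrix.one_apply_eq]
            exact h0L
          · rw [if_neg i0, if_neg iL, Matrix.one_apply_ne iL, sub_zero]
            exact mul_mem_fil (d := 2) (hiL2 i iL i0) tK_mem
      · have hzj' : z j = a.val 0 j * (tK * ω) := if_neg jL
        by_cases iL : i = L
        · have i0 : i ≠ 0 := fun h => hl (h.symm.trans iL)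
          rw [if_neg i0, if_neg i0, if_pos iL, if_pos iL, iL, Matrix.one_apply_ne (Ne.symm jL),
            hzj']
          have : a.val 0 j - a.val 0 L * (a.val 0 j * (tK * ω)) = 0 := by
            linear_combination (-a.val 0 j) * hrω
          rw [this, zero_mul, sub_zero]
          exact zero_mem _
        · by_cases j0 : j = 0
          · rw [j0, a0, _root_.zpow_neg, zpow_one]
            by_cases i0 : i = 0
            · rw [if_pos i0, if_pos i0, i0, hq0, Matrix.one_apply_eq]
              have e : (tK - Cc (w 0) - q L * z 0) * tK⁻¹ - 1
                  = -(Cc (w 0) * tK⁻¹) - q L * z 0 * tK⁻¹ := by linear_combination htt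
              rw [e]
              exact sub_mem (neg_mem (mul_mem_fil (d := 0) (Cc_mem _) tK_inv_mem))
                (fil_mono (by norm_num) (mul_mem_fil (mul_mem_fil hqL hz0) tK_inv_mem))
            · rw [if_neg i0, if_neg i0, if_neg iL, if_neg iL, hi0 i i0, Matrix.one_apply_ne i0,
                sub_zero, zero_sub]
              exact fil_mono (by norm_num)
                (mul_mem_fil (neg_mem (mul_mem_fil (hiL2 i iL i0) hz0)) tK_inv_mem)
          · have aj : alphaB k j = 0 := by
              rw [alphaB, if_neg j0, if_neg jL]
            rw [aj, neg_zero, zpow_zero, mul_one]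
            by_cases i0 : i = 0
            · rw [if_pos i0, if_pos i0, i0, Matrix.one_apply_ne (Ne.symm j0), sub_zero]
              exact sub_mem (hqj j j0 jL)
                (fil_mono (by norm_num) (mul_mem_fil hqL (hzj j j0 jL)))
            · rw [if_neg i0, if_neg i0, if_neg iL, if_neg iL, sub_right_comm]
              exact sub_mem (Uni.sub_one_mem ha i j)
                (fil_mono (by norm_num) (mul_mem_fil (hiL2 i iL i0) (hzj j j0 jL))))
  exact ⟨v, u, hu, d, l, hlm, hd, he⟩

end BlockGauss

/-! ### The fiber of `Φ_α` over `χ_α` -/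

section Fiber

variable {n r₁ r₂ k : ℕ}

/-- The fiber `Φ_α⁻¹(χ_α)` in `Gr_μ`. -/
def fiber (k : ℕ) (hrn : r₂ < n) (μ : Fin n → ℤ) : Set (Matrix (Fin n) (Fin n) K) :=
  {y | y ∈ GrSlice μ ∧
    PhiF n r₂ k hrn μ y = fun a : Fin k => if (a : ℕ) = k - 1 then (1 : ℂ) else 0}

variable (h : r₁ - 1 + k < n) (hl : (0 : Fin (k + 1)) ≠ Fin.last k) (hr : r₁ - 1 + k = r₂)
  {μ : Fin n → ℤ}

lemma phiF_eq_iff (hrn : r₂ < n) (hl : (0 : Fin (k + 1)) ≠ Fin.last k) (hr : r₁ - 1 + k = r₂)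
    {y u l : (Matrix (Fin n) (Fin n) K)ˣ}
    {d : Fin n → Kˣ} (g : Gauss μ y u d l) :
    (PhiF n r₂ k hrn μ y.val = fun a : Fin k => if (a : ℕ) = k - 1 then (1 : ℂ) else 0) ↔
      ∀ i ≠ Fin.last k, (u.val (blk h i) (blk h (Fin.last k))).coeff 1 = if i = 0 then 1 else 0 := by
  have hk : k ≠ 0 := fun hk => hl (Fin.ext hk.symm)
  have hL : blk h (Fin.last k) = ⟨r₂, hrn⟩ := Fin.ext hr
  rw [PhiF, g.gaussUF_eq, hL]
  constructor
  · intro H i hi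
    have hik : (i : ℕ) < k := Fin.val_lt_last hi
    have := congr_fun H ⟨k - 1 - i, by omega⟩
    have e : blk h i = ⟨r₂ - 1 - (k - 1 - i), by omega⟩ := Fin.ext (by simp only [blk]; omega)
    rw [e]
    refine this.trans (if_congr ?_ rfl rfl)
    rw [Fin.ext_iff, Fin.val_zero]
    dsimp only
    omega
  · intro H
    funext a
    have := H ⟨k - 1 - a, by omega⟩ (fun h => by
      have := congr_arg Fin.val h
      simp only [Fin.val_last] at this
      omega)
    have e : blk h ⟨k - 1 - a, by omega⟩ = ⟨r₂ - 1 - a, by omega⟩ :=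
      Fin.ext (by simp only [blk]; omega)
    rw [e] at this
    refine this.trans (if_congr ?_ rfl rfl)
    rw [Fin.ext_iff, Fin.val_zero]
    dsimp only
    omega

lemma alphaCo_blk (hl : (0 : Fin (k + 1)) ≠ Fin.last k) (hr : r₁ - 1 + k = r₂)
    (i : Fin (k + 1)) : alphaCo n r₁ r₂ (blk h i) = alphaB k i := by
  have hk : k ≠ 0 := fun hk => hl (Fin.ext hk.symm)
  simp only [alphaCo, alphaB, blk, Fin.ext_iff, Fin.val_last, Fin.val_zero]
  split_ifs <;> omega

lemma alphaCo_of_notMem (hr : r₁ - 1 + k = r₂) {i : Fin n} (hi : i ∉ Set.range (blk h)) :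
    alphaCo n r₁ r₂ i = 0 := by
  rw [mem_range_blk] at hi
  simp only [alphaCo]
  split_ifs <;> omega

/-- `y = p · τ_α(x₋(v) y(0,1,0,0)) · y₂ · m` with `p` in the unipotent radical over `ℂ[t]`
and `m ∈ N₋[t]`. -/
def Rel (v : Fin k → ℂ) (y y₂ : (Matrix (Fin n) (Fin n) K)ˣ) : Prop :=
  ∃ p ∈ Uni (cl n r₁ k) poly, ∃ m ∈ Uni (dn n) poly, y = p * tau h (xU v * sU hl) * y₂ * m

variable {h hl}

lemma exists_rel (hr : r₁ - 1 + k = r₂) (hrn : r₂ < n) (v : Fin k → ℂ)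
    {y₂ : (Matrix (Fin n) (Fin n) K)ˣ} (hy₂ : y₂.val ∈ GrSlice (addAlpha n r₁ r₂ μ)) :
    ∃ y : (Matrix (Fin n) (Fin n) K)ˣ, y.val ∈ fiber k hrn μ ∧ Rel h hl v y y₂ := by
  obtain ⟨y', u, d, l, g, e⟩ := mem_GrSlice_iff.1 hy₂
  obtain rfl : y₂ = y' := Units.ext e
  obtain ⟨a, ha, -, hau⟩ := exists_block h g.hu
  obtain ⟨ub, hub, db, lb, hlb, hdb, hc, hcoe⟩ := exists_gauss_xU_mul_sU hl v ha
  obtain ⟨p, hp, m, hm, u₂, d₂, l₂, g₂, hu₂⟩ := exists_gauss_translate h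
    (β' := fun i => -alphaCo n r₁ r₂ i) (fun i => by rw [alphaCo_blk h hl hr])
    (fun i hi => by rw [alphaCo_of_notMem h hr hi, neg_zero]) g hau hub hdb hlb hc
  have hμ : (fun i => addAlpha n r₁ r₂ μ i + -alphaCo n r₁ r₂ i) = μ := by
    funext i
    simp [addAlpha]
  rw [hμ] at g₂
  refine ⟨_, ⟨g₂.mem, (phiF_eq_iff h hrn hl hr g₂).2 fun i hi => ?_⟩, p, hp, m, hm, rfl⟩
  rw [hu₂]
  exact hcoe i hi

lemma exists_rel_of_mem_fiber (hr : r₁ - 1 + k = r₂) (hrn : r₂ < n)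
    {y : (Matrix (Fin n) (Fin n) K)ˣ} (hy : y.val ∈ fiber k hrn μ) :
    ∃ v, ∃ y₂ : (Matrix (Fin n) (Fin n) K)ˣ,
      y₂.val ∈ GrSlice (addAlpha n r₁ r₂ μ) ∧ Rel h hl v y y₂ := by
  obtain ⟨y', u, d, l, g, e⟩ := mem_GrSlice_iff.1 hy.1
  obtain rfl : y = y' := Units.ext e
  have hcoe := (phiF_eq_iff h hrn hl hr g).1 hy.2
  obtain ⟨a, ha, hav, hau⟩ := exists_block h g.hu
  obtain ⟨v, ub, hub, db, lb, hlb, hdb, hc⟩ := exists_gauss_inv_xU_mul_sU hl ha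
    (fun i hi => by rw [hav]; exact hcoe i hi)
  obtain ⟨p, hp, m, hm, u₂, d₂, l₂, g₂, -⟩ := exists_gauss_translate h
    (β' := alphaCo n r₁ r₂) (fun i => by rw [alphaCo_blk h hl hr])
    (fun i hi => alphaCo_of_notMem h hr hi) g hau hub hdb hlb hc
  refine ⟨v, _, g₂.mem, _, tau_conj_mem h one_mem_poly (xU_mul_sU_entries hl v)
    (xU_mul_sU_inv_entries hl v) (inv_mem hp), m⁻¹, inv_mem hm, ?_⟩
  rw [map_inv]
  group

/-- The slice element in terms of the other one, with a unitriangular polynomial factor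
recording `v`. -/
lemma Rel.exists_eq {v : Fin k → ℂ} {y y₂ : (Matrix (Fin n) (Fin n) K)ˣ} (H : Rel h hl v y y₂) :
    ∃ p ∈ Uni (cl n r₁ k) poly, ∃ m ∈ Uni (dn n) poly,
      y₂ = p * tau h ((sU hl)⁻¹ * xU (-v) * sU hl) * (tau h (sU hl)⁻¹ * y) * m := by
  obtain ⟨p, hp, m, hm, rfl⟩ := H
  refine ⟨_, tau_conj_mem h one_mem_poly (c := (xU v * sU hl)⁻¹) (xU_mul_sU_inv_entries hl v)
    (by rw [inv_inv]; exact xU_mul_sU_entries hl v) (inv_mem hp), m⁻¹, inv_mem hm, ?_⟩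
  rw [← xU_inv]
  simp only [map_mul, map_inv]
  group

lemma Rel.unique_right {v v' : Fin k → ℂ} {y y₂ y₂' : (Matrix (Fin n) (Fin n) K)ˣ}
    {ν : Fin n → ℤ} (hy₂ : y₂.val ∈ GrSlice ν) (hy₂' : y₂'.val ∈ GrSlice ν)
    (H : Rel h hl v y y₂) (H' : Rel h hl v' y y₂') : v = v' ∧ y₂ = y₂' := by
  obtain ⟨p, hp, m, hm, e⟩ := H.exists_eq
  obtain ⟨p', hp', m', hm', e'⟩ := H'.exists_eq
  obtain ⟨h1, h2⟩ := polyFactor_unique hy₂ hy₂'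
    (mul_mem (Uni_cl_le _ hp) (tau_mem_up h (sU_conj_xU_mem hl (-v))))
    (mul_mem (Uni_cl_le _ hp') (tau_mem_up h (sU_conj_xU_mem hl (-v')))) hm hm' e e'
  refine ⟨?_, h2⟩
  have h3 : tau h (((sU hl)⁻¹ * xU (-v) * sU hl) * ((sU hl)⁻¹ * xU (-v') * sU hl)⁻¹)
      = p⁻¹ * p' := by
    rw [map_mul, map_inv, mul_inv_eq_iff_eq_mul, mul_assoc p⁻¹, ← h1, inv_mul_cancel_left]
  have h4 : tau h (((sU hl)⁻¹ * xU (-v) * sU hl) * ((sU hl)⁻¹ * xU (-v') * sU hl)⁻¹)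
      ∈ Uni (cl n r₁ k) poly := by
    rw [h3]
    exact mul_mem (inv_mem hp) hp'
  have h5 := mul_inv_eq_one.1 (eq_one_of_tau_mem h h4)
  exact neg_injective (xU_injective (mul_left_cancel (mul_right_cancel h5)))

lemma Rel.unique_left {v : Fin k → ℂ} {y y' y₂ : (Matrix (Fin n) (Fin n) K)ˣ}
    (hy : y.val ∈ GrSlice μ) (hy' : y'.val ∈ GrSlice μ)
    (H : Rel h hl v y y₂) (H' : Rel h hl v y' y₂) : y = y' := by
  obtain ⟨p, hp, m, hm, e⟩ := H
  obtain ⟨p', hp', m', hm', e'⟩ := H'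
  rw [mul_assoc p] at e
  rw [mul_assoc p'] at e'
  exact (polyFactor_unique hy hy' (Uni_cl_le _ hp) (Uni_cl_le _ hp') hm hm' e e').2

lemma Rel.piF_eq {v : Fin k → ℂ} {y y₂ : (Matrix (Fin n) (Fin n) K)ˣ}
    (hy : y.val ∈ GrSlice μ) (H : Rel h hl v y y₂) :
    piF μ (blockEmbed n r₁ k (xU v * sU hl).val * y₂.val) = y.val := by
  obtain ⟨p, hp, m, hm, e⟩ := H
  rw [mul_assoc p] at e
  rw [← tau_val h, ← Units.val_mul]
  exact GaussSlice.piF_eq hy (Uni_cl_le _ hp) hm e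

lemma Rel.act (hr : r₁ - 1 + k = r₂) (hrn : r₂ < n) (v : Fin k → ℂ) {v₀ : Fin k → ℂ}
    {y y₂ : (Matrix (Fin n) (Fin n) K)ˣ} (hy₂ : y₂.val ∈ GrSlice (addAlpha n r₁ r₂ μ))
    (H : Rel h hl v₀ y y₂) :
    ∃ y' : (Matrix (Fin n) (Fin n) K)ˣ, y'.val ∈ fiber k hrn μ ∧
      piF μ (blockEmbed n r₁ k (xminusK k v) * y.val) = y'.val ∧ Rel h hl (v + v₀) y' y₂ := by
  obtain ⟨y', hy', H'⟩ := exists_rel (h := h) (hl := hl) hr hrn (v + v₀) hy₂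
  refine ⟨y', hy', ?_, H'⟩
  obtain ⟨p, hp, m, hm, e⟩ := H
  obtain ⟨p', hp', m', hm', e'⟩ := H'
  have hconj := tau_conj_mem h one_mem_poly (c := xU v) (xU_entries v)
    (by rw [xU_inv]; exact xU_entries _) hp
  refine GaussSlice.piF_eq (x := tau h (xU v) * y) hy'.1
    (Uni_cl_le _ (mul_mem hp' (inv_mem hconj))) (mul_mem (inv_mem hm) hm') ?_
  rw [e, e', ← xU_mul]
  simp only [map_mul]
  group

lemma exists_unit_of_mem_GrSlice {ν : Fin n → ℤ} {y : Matrix (Fin n) (Fin n) K}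
    (hy : y ∈ GrSlice ν) : ∃ y' : (Matrix (Fin n) (Fin n) K)ˣ, y = y'.val := by
  obtain ⟨y', -, -, -, -, e⟩ := mem_GrSlice_iff.1 hy
  exact ⟨y', e⟩

end Fiber

end GaussSlice

/-- With `χ_α = (0,…,0,1) ∈ ℂ^k`: (a) the fiber `Φ_α⁻¹(χ_α) ⊆ Gr_μ`
is exactly the set of elements `m(τ_α(y(p,1,0,g)), y₂)`; (b) `v·y := π(x_{−α}(v)·y)`
is a free action of `(ℂ^k,+)` on the fiber; and (c) `y₂ ↦ [m(τ_α(y(0,1,0,0)), y₂)]`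
is a bijection from `Gr_{μ+α}` onto the set of orbits, i.e. the set-theoretic
Hamiltonian reduction `Φ_α⁻¹(χ_α)/ℂ^k` is in bijection with `Gr_{μ+α}`. -/
theorem statement16 (n r₁ r₂ k : ℕ) (hn : 2 ≤ n) (hr1 : 1 ≤ r₁) (hrr : r₁ ≤ r₂)
    (hrn : r₂ < n) (hk : k = r₂ - r₁ + 1) (μ : Fin n → ℤ) :
    -- (a) description of the fiber
    ({y | y ∈ GrSlice μ ∧
        PhiF n r₂ k hrn μ y = fun a : Fin k => if (a : ℕ) = k - 1 then (1 : ℂ) else 0} =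
      {z | ∃ (p : ℂ) (g : Fin (k-1) → ℂ) (y₂ : Matrix (Fin n) (Fin n) K),
        y₂ ∈ GrSlice (addAlpha n r₁ r₂ μ) ∧
        z = piF μ (blockEmbed n r₁ k (ymat k p 1 0 g) * y₂)}) ∧
    -- (b) `v · y := π(x_{−α}(v)·y)` is a free action of `(ℂ^k, +)` on the fiber
    (∀ y ∈ {y | y ∈ GrSlice μ ∧
        PhiF n r₂ k hrn μ y = fun a : Fin k => if (a : ℕ) = k - 1 then (1 : ℂ) else 0},
      (∀ v : Fin k → ℂ,
        piF μ (blockEmbed n r₁ k (xminusK k v) * y) ∈ GrSlice μ ∧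
        PhiF n r₂ k hrn μ (piF μ (blockEmbed n r₁ k (xminusK k v) * y)) =
          fun a : Fin k => if (a : ℕ) = k - 1 then (1 : ℂ) else 0) ∧
      piF μ (blockEmbed n r₁ k (xminusK k 0) * y) = y ∧
      (∀ v w : Fin k → ℂ,
        piF μ (blockEmbed n r₁ k (xminusK k (v + w)) * y) =
          piF μ (blockEmbed n r₁ k (xminusK k v) *
            piF μ (blockEmbed n r₁ k (xminusK k w) * y))) ∧
      (∀ v : Fin k → ℂ,
        piF μ (blockEmbed n r₁ k (xminusK k v) * y) = y → v = 0)) ∧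
    -- (c) `Gr_{μ+α}` is in bijection with the set of orbits
    (∀ y₂ ∈ GrSlice (addAlpha n r₁ r₂ μ),
      piF μ (blockEmbed n r₁ k (ymat k 0 1 0 0) * y₂) ∈
        {y | y ∈ GrSlice μ ∧
          PhiF n r₂ k hrn μ y =
            fun a : Fin k => if (a : ℕ) = k - 1 then (1 : ℂ) else 0}) ∧
    (∀ z ∈ {y | y ∈ GrSlice μ ∧
        PhiF n r₂ k hrn μ y = fun a : Fin k => if (a : ℕ) = k - 1 then (1 : ℂ) else 0},
      ∃ y₂ ∈ GrSlice (addAlpha n r₁ r₂ μ), ∃ v : Fin k → ℂ,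
        z = piF μ (blockEmbed n r₁ k (xminusK k v) *
              piF μ (blockEmbed n r₁ k (ymat k 0 1 0 0) * y₂))) ∧
    (∀ y₂ ∈ GrSlice (addAlpha n r₁ r₂ μ), ∀ y₂' ∈ GrSlice (addAlpha n r₁ r₂ μ),
      (∃ v : Fin k → ℂ,
        piF μ (blockEmbed n r₁ k (xminusK k v) *
            piF μ (blockEmbed n r₁ k (ymat k 0 1 0 0) * y₂)) =
          piF μ (blockEmbed n r₁ k (ymat k 0 1 0 0) * y₂')) →
      y₂ = y₂') := by
  have h : r₁ - 1 + k < n := by omega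
  have hr : r₁ - 1 + k = r₂ := by omega
  have hl : (0 : Fin (k + 1)) ≠ Fin.last k := fun e => by
    have := congr_arg Fin.val e
    simp only [Fin.val_last, Fin.val_zero] at this
    omega
  have h0 : (GaussSlice.xU 0 * GaussSlice.sU hl).val = ymat k 0 1 0 0 :=
    GaussSlice.ymat_eq hl 0 0 0 (fun _ _ => by simp) (fun _ _ _ => by simp)
  refine ⟨?_, ?_, ?_, ?_, ?_⟩
  · refine Set.Subset.antisymm (fun z hz => ?_) ?_
    · obtain ⟨y, rfl⟩ := GaussSlice.exists_unit_of_mem_GrSlice hz.1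
      obtain ⟨v, y₂, hy₂, H⟩ :=
        GaussSlice.exists_rel_of_mem_fiber (h := h) (hl := hl) (μ := μ) hr hrn hz
      refine ⟨-v ⟨k - 1, by omega⟩, fun i => -v ⟨i, by omega⟩, y₂.val, hy₂, ?_⟩
      rw [← GaussSlice.ymat_eq hl _ _ v
        (fun i hi => by rw [show i = ⟨k - 1, by omega⟩ from Fin.ext hi])
        (fun i j hj => by rw [show j = ⟨i, by omega⟩ from Fin.ext hj])]
      exact (H.piF_eq hz.1).symm
    · rintro _ ⟨p, g, y₂, hy₂, rfl⟩
      obtain ⟨y₂, rfl⟩ := GaussSlice.exists_unit_of_mem_GrSlice hy₂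
      obtain ⟨v, hv⟩ : ∃ v : Fin k → ℂ,
          v = fun i : Fin k => if hi : (i : ℕ) = k - 1 then -p else -g ⟨i, by omega⟩ := ⟨_, rfl⟩
      obtain ⟨y, hy, H⟩ := GaussSlice.exists_rel (h := h) (hl := hl) hr hrn v hy₂
      have e : (GaussSlice.xU v * GaussSlice.sU hl).val = ymat k p 1 0 g := by
        refine GaussSlice.ymat_eq hl p g v (fun i hi => ?_) (fun i j hj => ?_)
        · rw [hv]
          dsimp only
          rw [dif_pos hi, neg_neg]
        · rw [hv]
          dsimp only
          rw [dif_neg (by omega), neg_neg]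
          exact congr_arg g (Fin.ext hj.symm)
      rw [← e, H.piF_eq hy.1]
      exact hy
  · intro z hz
    obtain ⟨y, rfl⟩ := GaussSlice.exists_unit_of_mem_GrSlice hz.1
    obtain ⟨v₀, y₂, hy₂, H⟩ :=
      GaussSlice.exists_rel_of_mem_fiber (h := h) (hl := hl) (μ := μ) hr hrn hz
    refine ⟨fun v => ?_, ?_, fun v w => ?_, fun v hv => ?_⟩
    · obtain ⟨y', hy', e, -⟩ := H.act hr hrn v hy₂
      rw [e]
      exact hy'
    · obtain ⟨y', hy', e, H'⟩ := H.act hr hrn 0 hy₂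
      rw [zero_add] at H'
      rw [e, H.unique_left hz.1 hy'.1 H']
    · obtain ⟨y', hy', e, H'⟩ := H.act hr hrn w hy₂
      obtain ⟨y'', hy'', e', H''⟩ := H'.act hr hrn v hy₂
      obtain ⟨x, hx, ex, Hx⟩ := H.act hr hrn (v + w) hy₂
      rw [add_assoc] at Hx
      rw [ex, e, e', H''.unique_left hy''.1 hx.1 Hx]
    · obtain ⟨y', hy', e, H'⟩ := H.act hr hrn v hy₂
      obtain rfl : y' = y := Units.ext (e.symm.trans hv)
      exact add_eq_right.1 (H'.unique_right hy₂ hy₂ H).1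
  · intro y₂ hy₂
    obtain ⟨y₂, rfl⟩ := GaussSlice.exists_unit_of_mem_GrSlice hy₂
    obtain ⟨y, hy, H⟩ := GaussSlice.exists_rel (h := h) (hl := hl) hr hrn 0 hy₂
    rw [← h0, H.piF_eq hy.1]
    exact hy
  · intro z hz
    obtain ⟨x, rfl⟩ := GaussSlice.exists_unit_of_mem_GrSlice hz.1
    obtain ⟨v, y₂, hy₂, Hx⟩ :=
      GaussSlice.exists_rel_of_mem_fiber (h := h) (hl := hl) (μ := μ) hr hrn hz
    obtain ⟨y, hy, H⟩ := GaussSlice.exists_rel (h := h) (hl := hl) hr hrn 0 hy₂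
    obtain ⟨y', hy', e, H'⟩ := H.act hr hrn v hy₂
    rw [add_zero] at H'
    refine ⟨y₂.val, hy₂, v, ?_⟩
    rw [← h0, H.piF_eq hy.1, e, Hx.unique_left hz.1 hy'.1 H']
  · rintro y₂ hy₂ y₂' hy₂' ⟨v, hv⟩
    obtain ⟨y₂, rfl⟩ := GaussSlice.exists_unit_of_mem_GrSlice hy₂
    obtain ⟨y₂', rfl⟩ := GaussSlice.exists_unit_of_mem_GrSlice hy₂'
    obtain ⟨y, hy, H⟩ := GaussSlice.exists_rel (h := h) (hl := hl) hr hrn 0 hy₂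
    obtain ⟨x, hx, Hx⟩ := GaussSlice.exists_rel (h := h) (hl := hl) hr hrn 0 hy₂'
    obtain ⟨y', hy', e, H'⟩ := H.act hr hrn v hy₂
    rw [← h0, H.piF_eq hy.1, Hx.piF_eq hx.1, e] at hv
    obtain rfl : y' = x := Units.ext hv
    rw [(H'.unique_right hy₂ hy₂' Hx).2]

end
end

section
/- Fix n ≥ 2. Every upper unitriangular matrix u ∈ GL_n(K) factors uniquely as u = n·u₁ with n an upper unitriangular matrix with entries in ℂ[t] and u₁ an upper unitriangular matrix with all off-diagonal entries in 𝒪₁ = t⁻¹ℂ[[t⁻¹]]. Likewise, every lower unitriangular matrix over K factors uniquely as a product of a lower unitriangular matrix with entries in ℂ[t] and a lower unitriangular matrix with off-diagonal entries in 𝒪₁. -/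
open Matrix

noncomputable section

/-- The `(i, j)` entry of a product of upper unitriangular matrices, above the diagonal. -/
theorem IsUpperUni.mul_apply_of_lt {R : Type*} [Ring R] {m : ℕ}
    {a b : Matrix (Fin m) (Fin m) R} (ha : IsUpperUni a) (hb : IsUpperUni b)
    {i j : Fin m} (hij : i < j) :
    (a * b) i j = a i j + b i j + ∑ k ∈ Finset.Ioo i j, a i k * b k j := by
  have hsupp : ∑ k ∈ Finset.Icc i j, a i k * b k j = ∑ k, a i k * b k j := by
    refine Finset.sum_subset (Finset.subset_univ _) fun k _ hk => ?_
    rw [Finset.mem_Icc, not_and_or, not_le, not_le] at hk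
    rcases hk with hk | hk
    · rw [ha.2 i k hk, zero_mul]
    · rw [hb.2 k j hk, mul_zero]
  rw [Matrix.mul_apply, ← hsupp, ← Finset.Ioc_insert_left hij.le,
    Finset.sum_insert Finset.left_notMem_Ioc, ← Finset.Ioo_insert_right hij,
    Finset.sum_insert Finset.right_notMem_Ioo, ha.1, hb.1, one_mul, mul_one]
  abel

theorem IsUpperUni.mul {R : Type*} [Ring R] {m : ℕ} {a b : Matrix (Fin m) (Fin m) R}
    (ha : IsUpperUni a) (hb : IsUpperUni b) : IsUpperUni (a * b) := by
  constructor
  · intro i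
    rw [Matrix.mul_apply, Finset.sum_eq_single i, ha.1, hb.1, one_mul]
    · intro k _ hk
      rcases lt_or_gt_of_ne hk with hk | hk
      · rw [ha.2 i k hk, zero_mul]
      · rw [hb.2 k i hk, mul_zero]
    · simp
  · intro i j hij
    rw [Matrix.mul_apply]
    refine Finset.sum_eq_zero fun k _ => ?_
    rcases lt_or_ge k i with hk | hk
    · rw [ha.2 i k hk, zero_mul]
    · rw [hb.2 k j (hij.trans_le hk), mul_zero]

/-- Upper unitriangular matrices agree as soon as their entries above the diagonal do. -/
theorem IsUpperUni.ext {R : Type*} [Zero R] [One R] {m : ℕ} {a b : Matrix (Fin m) (Fin m) R}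
    (ha : IsUpperUni a) (hb : IsUpperUni b) (h : ∀ i j, i < j → a i j = b i j) : a = b := by
  ext i j
  rcases lt_trichotomy i j with hij | rfl | hij
  · exact h i j hij
  · rw [ha.1, hb.1]
  · rw [ha.2 i j hij, hb.2 i j hij]

/-- The upper unitriangular matrix with prescribed entries above the diagonal. -/
def upperUniOf {R : Type*} [Zero R] [One R] {m : ℕ} (f : Fin m → Fin m → R) :
    Matrix (Fin m) (Fin m) R :=
  fun i j => if i < j then f i j else if i = j then 1 else 0

theorem upperUniOf_apply_of_lt {R : Type*} [Zero R] [One R] {m : ℕ} (f : Fin m → Fin m → R)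
    {i j : Fin m} (hij : i < j) : upperUniOf f i j = f i j :=
  if_pos hij

theorem isUpperUni_upperUniOf {R : Type*} [Zero R] [One R] {m : ℕ} (f : Fin m → Fin m → R) :
    IsUpperUni (upperUniOf f) :=
  ⟨fun i => by simp [upperUniOf], fun i j hij => by simp [upperUniOf, hij.not_gt, hij.ne']⟩

theorem upperUniOf_mem {R : Type*} [Ring R] {m : ℕ} {f : Fin m → Fin m → R} {P : AddSubgroup R}
    (hf : ∀ i j, f i j ∈ P) {i j : Fin m} (hij : i ≠ j) : upperUniOf f i j ∈ P := by
  unfold upperUniOf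
  split_ifs
  exacts [hf i j, P.zero_mem]

/-- The entries above the diagonal of the two factors of `u`, obtained by splitting the
entries of `u` with `p`, recursively in the distance to the diagonal. -/
def uniFactor {R : Type*} [Ring R] {m : ℕ} (p : R → R) (u : Matrix (Fin m) (Fin m) R)
    (i j : Fin m) : R × R :=
  let s := u i j - ∑ k : Finset.Ioo i j, (uniFactor p u i k).1 * (uniFactor p u k j).2
  (p s, s - p s)
termination_by (j : ℕ) - i
decreasing_by
  all_goals
    have hk := Finset.mem_Ioo.1 k.2
    simp only [Fin.lt_def] at hk
    omega

theorem uniFactor_fst_mem {R : Type*} [Ring R] {m : ℕ} {p : R → R} {P : AddSubgroup R}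
    (hp : ∀ x, p x ∈ P) (u : Matrix (Fin m) (Fin m) R) (i j : Fin m) :
    (uniFactor p u i j).1 ∈ P := by
  rw [uniFactor]
  exact hp _

theorem uniFactor_snd_mem {R : Type*} [Ring R] {m : ℕ} {p : R → R} {Q : AddSubgroup R}
    (hp : ∀ x, x - p x ∈ Q) (u : Matrix (Fin m) (Fin m) R) (i j : Fin m) :
    (uniFactor p u i j).2 ∈ Q := by
  rw [uniFactor]
  exact hp _

theorem uniFactor_add {R : Type*} [Ring R] {m : ℕ} (p : R → R) (u : Matrix (Fin m) (Fin m) R)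
    (i j : Fin m) :
    (uniFactor p u i j).1 + (uniFactor p u i j).2 +
      ∑ k ∈ Finset.Ioo i j, (uniFactor p u i k).1 * (uniFactor p u k j).2 = u i j := by
  rw [← Finset.sum_coe_sort, uniFactor, add_sub_cancel, sub_add_cancel]

/-- If `R = P ⊕ Q` additively, an upper unitriangular matrix over `R` factors uniquely into
upper unitriangular matrices with off-diagonal entries in `P` and in `Q` respectively. -/
theorem IsUpperUni.existsUnique_mul {R : Type*} [Ring R] {m : ℕ} {P Q : AddSubgroup R}
    (hPQ : Disjoint P Q) {p : R → R} (hP : ∀ x, p x ∈ P) (hQ : ∀ x, x - p x ∈ Q)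
    {u : Matrix (Fin m) (Fin m) R} (hu : IsUpperUni u) :
    ∃! ab : Matrix (Fin m) (Fin m) R × Matrix (Fin m) (Fin m) R,
      (IsUpperUni ab.1 ∧ ∀ i j, i ≠ j → ab.1 i j ∈ P) ∧
      (IsUpperUni ab.2 ∧ ∀ i j, i ≠ j → ab.2 i j ∈ Q) ∧ u = ab.1 * ab.2 := by
  refine existsUnique_of_exists_of_unique ?_ ?_
  · have ha := isUpperUni_upperUniOf fun i j => (uniFactor p u i j).1
    have hb := isUpperUni_upperUniOf fun i j => (uniFactor p u i j).2
    refine ⟨(upperUniOf fun i j => (uniFactor p u i j).1,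
        upperUniOf fun i j => (uniFactor p u i j).2),
      ⟨ha, fun i j => upperUniOf_mem (uniFactor_fst_mem hP u)⟩,
      ⟨hb, fun i j => upperUniOf_mem (uniFactor_snd_mem hQ u)⟩,
      hu.ext (ha.mul hb) fun i j hij => ?_⟩
    rw [ha.mul_apply_of_lt hb hij, upperUniOf_apply_of_lt _ hij, upperUniOf_apply_of_lt _ hij,
      ← uniFactor_add p u i j]
    congr 1
    refine Finset.sum_congr rfl fun k hk => ?_
    rw [Finset.mem_Ioo] at hk
    rw [upperUniOf_apply_of_lt _ hk.1, upperUniOf_apply_of_lt _ hk.2]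
  · rintro ⟨a, b⟩ ⟨c, d⟩ ⟨⟨ha, haP⟩, ⟨hb, hbQ⟩, hab⟩ ⟨⟨hc, hcP⟩, ⟨hd, hdQ⟩, hcd⟩
    have key : ∀ (N : ℕ) (i j : Fin m), (j : ℕ) - i = N → i < j →
        a i j = c i j ∧ b i j = d i j := by
      intro N
      induction N using Nat.strong_induction_on with
      | _ N ih =>
        intro i j hN hij
        have hsum : ∑ k ∈ Finset.Ioo i j, a i k * b k j =
            ∑ k ∈ Finset.Ioo i j, c i k * d k j := by
          refine Finset.sum_congr rfl fun k hk => ?_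
          obtain ⟨hik, hkj⟩ := Finset.mem_Ioo.1 hk
          rw [(ih _ (by simp only [Fin.lt_def] at hik hkj; omega) i k rfl hik).1,
            (ih _ (by simp only [Fin.lt_def] at hik hkj; omega) k j rfl hkj).2]
        have hentry : (a * b) i j = (c * d) i j := by rw [← hab, ← hcd]
        rw [ha.mul_apply_of_lt hb hij, hc.mul_apply_of_lt hd hij, hsum,
          add_left_inj] at hentry
        have hsub : a i j - c i j = d i j - b i j := by
          rw [sub_eq_sub_iff_add_eq_add, hentry, add_comm]
        have hzero : a i j - c i j = 0 := by
          refine AddSubgroup.disjoint_def.1 hPQ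
            (P.sub_mem (haP i j hij.ne) (hcP i j hij.ne)) ?_
          rw [hsub]
          exact Q.sub_mem (hdQ i j hij.ne) (hbQ i j hij.ne)
        exact ⟨sub_eq_zero.1 hzero, (sub_eq_zero.1 (hsub ▸ hzero)).symm⟩
    exact Prod.ext (ha.ext hc fun i j hij => (key _ i j rfl hij).1)
      (hb.ext hd fun i j hij => (key _ i j rfl hij).2)

/-- `ℂ[t]` as an additive subgroup of `K`. -/
def polySubgroup : AddSubgroup K where
  carrier := {f | memPoly f}
  add_mem' hf hg j hj := by simp [hf j hj, hg j hj]
  zero_mem' _ _ := by simp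
  neg_mem' hf j hj := by simp [hf j hj]

/-- `t⁻¹ℂ[[t⁻¹]]` as an additive subgroup of `K`. -/
def o1Subgroup : AddSubgroup K where
  carrier := {f | memO1 f}
  add_mem' hf hg j hj := by simp [hf j hj, hg j hj]
  zero_mem' _ _ := by simp
  neg_mem' hf j hj := by simp [hf j hj]

theorem disjoint_polySubgroup_o1Subgroup : Disjoint polySubgroup o1Subgroup := by
  rw [AddSubgroup.disjoint_def]
  intro f hf hg
  ext j
  rcases lt_or_ge 0 j with hj | hj
  exacts [hf j hj, hg j hj]

theorem truncLT_one_mem_polySubgroup (f : K) : HahnSeries.truncLT 1 f ∈ polySubgroup :=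
  fun _ hj => HahnSeries.coeff_truncLT_of_le (Int.add_one_le_iff.2 hj) f

theorem sub_truncLT_one_mem_o1Subgroup (f : K) : f - HahnSeries.truncLT 1 f ∈ o1Subgroup :=
  fun j hj => by
    rw [HahnSeries.coeff_sub, HahnSeries.coeff_truncLT_of_lt (by omega), sub_self]

theorem memNpoly_iff {m : ℕ} {M : Matrix (Fin m) (Fin m) K} :
    MemNpoly M ↔ IsUpperUni M ∧ ∀ i j, i ≠ j → M i j ∈ polySubgroup := by
  refine and_congr_right fun hM => ⟨fun h i j _ => h i j, fun h i j => ?_⟩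
  rcases eq_or_ne i j with rfl | hij
  · intro k hk
    rw [hM.1, HahnSeries.coeff_one, if_neg hk.ne']
  · exact h i j hij

theorem existsUnique_memNpoly_mul_memN1 {m : ℕ} {u : Matrix (Fin m) (Fin m) K}
    (hu : IsUpperUni u) :
    ∃! ab : Matrix (Fin m) (Fin m) K × Matrix (Fin m) (Fin m) K,
      MemNpoly ab.1 ∧ MemN1 ab.2 ∧ u = ab.1 * ab.2 := by
  simp only [memNpoly_iff]
  exact hu.existsUnique_mul disjoint_polySubgroup_o1Subgroup truncLT_one_mem_polySubgroup
    sub_truncLT_one_mem_o1Subgroup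

/-- Reversing the order of the rows and of the columns. -/
def revEquiv (R : Type*) (m : ℕ) : Matrix (Fin m) (Fin m) R ≃ Matrix (Fin m) (Fin m) R :=
  Matrix.reindex Fin.revPerm Fin.revPerm

theorem revEquiv_apply {R : Type*} {m : ℕ} (M : Matrix (Fin m) (Fin m) R) (i j : Fin m) :
    revEquiv R m M i j = M i.rev j.rev :=
  rfl

theorem revEquiv_mul {R : Type*} [Ring R] {m : ℕ} (a b : Matrix (Fin m) (Fin m) R) :
    revEquiv R m (a * b) = revEquiv R m a * revEquiv R m b :=
  (Matrix.submatrix_mul_equiv a b _ _ _).symm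

theorem isUpperUni_revEquiv {R : Type*} [Zero R] [One R] {m : ℕ}
    {M : Matrix (Fin m) (Fin m) R} : IsUpperUni (revEquiv R m M) ↔ IsLowerUni M := by
  refine and_congr (Fin.revPerm.forall_congr fun i => Iff.rfl)
    (Fin.revPerm.forall_congr fun i => Fin.revPerm.forall_congr fun j => ?_)
  rw [Fin.revPerm_apply, Fin.revPerm_apply, Fin.rev_lt_rev, revEquiv_apply]

theorem memNpoly_revEquiv {m : ℕ} {M : Matrix (Fin m) (Fin m) K} :
    MemNpoly (revEquiv K m M) ↔ MemNnegPoly M := by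
  exact and_congr isUpperUni_revEquiv
    (Fin.revPerm.forall_congr fun i => Fin.revPerm.forall_congr fun j => Iff.rfl)

theorem memN1_revEquiv {m : ℕ} {M : Matrix (Fin m) (Fin m) K} :
    MemN1 (revEquiv K m M) ↔ MemN1neg M := by
  refine and_congr isUpperUni_revEquiv
    (Fin.revPerm.forall_congr fun i => Fin.revPerm.forall_congr fun j => ?_)
  rw [Fin.revPerm.injective.ne_iff]
  exact Iff.rfl

theorem existsUnique_memNnegPoly_mul_memN1neg {m : ℕ} {l : Matrix (Fin m) (Fin m) K}
    (hl : IsLowerUni l) :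
    ∃! ab : Matrix (Fin m) (Fin m) K × Matrix (Fin m) (Fin m) K,
      MemNnegPoly ab.1 ∧ MemN1neg ab.2 ∧ l = ab.1 * ab.2 := by
  have h := existsUnique_memNpoly_mul_memN1 (isUpperUni_revEquiv.2 hl)
  rw [← ((revEquiv K m).prodCongr (revEquiv K m)).existsUnique_congr_right] at h
  simpa only [Equiv.prodCongr_apply, Prod.map, memNpoly_revEquiv, memN1_revEquiv,
    ← revEquiv_mul, (revEquiv K m).apply_eq_iff_eq] using h

/-- Every upper (resp. lower) unitriangular matrix over
`K = ℂ((t⁻¹))` factors uniquely as a product of an upper (resp. lower) unitriangular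
matrix with entries in `ℂ[t]` and an upper (resp. lower) unitriangular matrix with
off-diagonal entries in `t⁻¹ℂ[[t⁻¹]]`. -/
theorem statement17 (n : ℕ) (hn : 2 ≤ n)
    (u l : Matrix (Fin n) (Fin n) K) (hu : IsUpperUni u) (hl : IsLowerUni l) :
    (∃! ab : Matrix (Fin n) (Fin n) K × Matrix (Fin n) (Fin n) K,
      MemNpoly ab.1 ∧ MemN1 ab.2 ∧ u = ab.1 * ab.2) ∧
    (∃! ab : Matrix (Fin n) (Fin n) K × Matrix (Fin n) (Fin n) K,
      MemNnegPoly ab.1 ∧ MemN1neg ab.2 ∧ l = ab.1 * ab.2) :=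
  ⟨existsUnique_memNpoly_mul_memN1 hu, existsUnique_memNnegPoly_mul_memN1neg hl⟩

end
end
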